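/- There exists a constant c > 0 such that for every n ≥ 1 the following holds. Let G₁ be a simple graph on a vertex set V₁ of size n that admits a crossing-free straight-line drawing in ℝ², and let G₂ be a simple graph on a vertex set V₂ of size n that admits a crossing-free straight-line drawing with all vertex images in strictly convex position (i.e., G₂ is outerplanar). Then there exist crossing-free straight-line drawings f₁ of G₁ and f₂ of G₂ such that f₁ and f₂ have the same image, and this common image consists of n integer points with first coordinates in [0, c·n²] and second coordinates in [0, c·n³]. That is, a planar graph and an outerplanar graph on n vertices can be simultaneously embedded without mapping on an O(n²) × O(n³) grid. -/

import Mathlib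

def IsCrossingFreeDrawing {V : Type*} (G : SimpleGraph V) (f : V → ℝ × ℝ) : Prop :=
  Function.Injective f ∧
    ∀ a b c d : V, G.Adj a b → G.Adj c d → s(a, b) ≠ s(c, d) →
      segment ℝ (f a) (f b) ∩ segment ℝ (f c) (f d) = f '' (({a, b} : Set V) ∩ {c, d})

/-- A set of points is in strictly convex position if no point of it lies in the
convex hull of the others. -/
def InStrictlyConvexPosition (s : Set (ℝ × ℝ)) : Prop :=
  ∀ p ∈ s, p ∉ convexHull ℝ (s \ {p})

/-- Triangulated discs: `Disc n L S E` says that `E` is the edge set (of size `n`) of a simple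
triangulated disc with vertex set `S` and boundary cycle `L`; the edge closing up the cycle `L`
is the last one to be added. -/
inductive Disc {V : Type*} : ℕ → List V → Set V → Set (Sym2 V) → Prop
  | edge {x y : V} (hxy : x ≠ y) : Disc 1 [x, y] {x, y} {s(x, y)}
  | join {m n : ℕ} {x z d : V} {l₁ l₂ : List V} {S₁ S₂ : Set V} {E₁ E₂ : Set (Sym2 V)}
      (h₁ : Disc m (x :: (l₁ ++ [d])) S₁ E₁) (h₂ : Disc n (d :: (l₂ ++ [z])) S₂ E₂)
      (hS : S₁ ∩ S₂ = {d}) :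
      Disc (m + n + 1) (x :: (l₁ ++ d :: (l₂ ++ [z]))) (S₁ ∪ S₂) (insert s(z, x) (E₁ ∪ E₂))
  | cover {n : ℕ} {c x z : V} {l : List V} {S : Set V} {E : Set (Sym2 V)}
      (h : Disc n (c :: x :: (l ++ [z])) S E) (hE : s(z, x) ∉ E) :
      Disc (n + 1) (x :: (l ++ [z])) S (insert s(z, x) E)

namespace Disc

variable {V : Type*}

theorem congr {n n' : ℕ} {L L' : List V} {S S' : Set V} {E E' : Set (Sym2 V)}
    (h : Disc n L S E) (hn : n = n') (hL : L = L') (hS : S = S') (hE : E = E') :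
    Disc n' L' S' E' := by
  subst hn hL hS hE; exact h

theorem inv {n : ℕ} {L : List V} {S : Set V} {E : Set (Sym2 V)} (h : Disc n L S E) :
    (∃ x y, x ≠ y ∧ n = 1 ∧ L = [x, y] ∧ S = {x, y} ∧ E = {s(x, y)}) ∨
    (∃ m k x z d l₁ l₂ S₁ S₂ E₁ E₂, Disc m (x :: (l₁ ++ [d])) S₁ E₁ ∧
      Disc k (d :: (l₂ ++ [z])) S₂ E₂ ∧ S₁ ∩ S₂ = {d} ∧ n = m + k + 1 ∧
      L = x :: (l₁ ++ d :: (l₂ ++ [z])) ∧ S = S₁ ∪ S₂ ∧ E = insert s(z, x) (E₁ ∪ E₂)) ∨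
    (∃ m c x z l E', Disc m (c :: x :: (l ++ [z])) S E' ∧ s(z, x) ∉ E' ∧ n = m + 1 ∧
      L = x :: (l ++ [z]) ∧ E = insert s(z, x) E') := by
  cases h with
  | edge hxy => exact Or.inl ⟨_, _, hxy, rfl, rfl, rfl, rfl⟩
  | join h₁ h₂ hS =>
    exact Or.inr (Or.inl ⟨_, _, _, _, _, _, _, _, _, _, _, h₁, h₂, hS, rfl, rfl, rfl, rfl⟩)
  | cover h hE => exact Or.inr (Or.inr ⟨_, _, _, _, _, _, h, hE, rfl, rfl, rfl⟩)

theorem pos {n : ℕ} {L : List V} {S : Set V} {E : Set (Sym2 V)} (h : Disc n L S E) : 0 < n := by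
  cases h <;> omega

theorem mem_of_mem {n : ℕ} {L : List V} {S : Set V} {E : Set (Sym2 V)} (h : Disc n L S E) :
    ∀ v ∈ L, v ∈ S := by
  induction h with
  | edge hxy => simp
  | join h₁ h₂ hS ih₁ ih₂ => grind
  | cover h hE ih => grind

theorem edge_mem {n : ℕ} {L : List V} {S : Set V} {E : Set (Sym2 V)} (h : Disc n L S E) :
    ∀ u w, s(u, w) ∈ E → u ∈ S ∧ w ∈ S := by
  induction h with
  | edge hxy => grind
  | join h₁ h₂ hS ih₁ ih₂ =>
    have := h₁.mem_of_mem; have := h₂.mem_of_mem; grind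
  | cover h hE ih => have := h.mem_of_mem; grind

theorem nodup {n : ℕ} {L : List V} {S : Set V} {E : Set (Sym2 V)} (h : Disc n L S E) :
    L.Nodup := by
  induction h with
  | edge hxy => simp [hxy]
  | @join m n x z d l₁ l₂ S₁ S₂ E₁ E₂ h₁ h₂ hS ih₁ ih₂ =>
    have a := h₁.mem_of_mem
    have b := h₂.mem_of_mem
    have key : ∀ v, v ∈ S₁ → v ∈ S₂ → v = d := fun v h h' => by
      have : v ∈ S₁ ∩ S₂ := ⟨h, h'⟩
      simpa [hS] using this
    rw [← List.cons_append, List.nodup_append]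
    refine ⟨?_, ih₂, ?_⟩
    · rw [← List.cons_append, List.nodup_append] at ih₁
      exact ih₁.1
    · rintro u hu _ hw rfl
      have : u = d := key u (a _ (by grind)) (b _ hw)
      subst this
      rw [← List.cons_append, List.nodup_append] at ih₁
      exact ih₁.2.2 u hu u (by simp) rfl
  | cover h hE ih => exact (List.nodup_cons.1 ih).2

theorem isChain {n : ℕ} {L : List V} {S : Set V} {E : Set (Sym2 V)} (h : Disc n L S E) :
    L.IsChain (fun u w => s(u, w) ∈ E) := by
  induction h with
  | edge hxy => simp
  | @join m n x z d l₁ l₂ S₁ S₂ E₁ E₂ h₁ h₂ hS ih₁ ih₂ =>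
    have := List.IsChain.append_overlap (l₁ := x :: l₁) (l₂ := [d]) (l₃ := l₂ ++ [z])
      (R := fun u w => s(u, w) ∈ insert s(z, x) (E₁ ∪ E₂))
      (List.IsChain.imp (by grind) ih₁) (List.IsChain.imp (by grind) ih₂) (by simp)
    simpa using this
  | @cover n c x z l S E h hE ih =>
    exact List.IsChain.imp (by grind) (List.IsChain.tail ih)

theorem inv_cons_append {n : ℕ} {x z : V} {l : List V} {S : Set V} {E : Set (Sym2 V)}
    (h : Disc n (x :: (l ++ [z])) S E) :
    (x ≠ z ∧ n = 1 ∧ l = [] ∧ S = {x, z} ∧ E = {s(x, z)}) ∨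
    (∃ m k d l₁ l₂ S₁ S₂ E₁ E₂, Disc m (x :: (l₁ ++ [d])) S₁ E₁ ∧
      Disc k (d :: (l₂ ++ [z])) S₂ E₂ ∧ S₁ ∩ S₂ = {d} ∧ n = m + k + 1 ∧
      l = l₁ ++ d :: l₂ ∧ S = S₁ ∪ S₂ ∧ E = insert s(z, x) (E₁ ∪ E₂)) ∨
    (∃ m c E', Disc m (c :: x :: (l ++ [z])) S E' ∧ s(z, x) ∉ E' ∧ n = m + 1 ∧
      E = insert s(z, x) E') := by
  obtain ⟨x', y', hxy, hn, hL, hS, hE⟩ |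
    ⟨m, k, x', z', d, l₁, l₂, S₁, S₂, E₁, E₂, h₁, h₂, hS, hn, hL, hS', hE⟩ |
    ⟨m, c, x', z', l', E', hd, hz, hn, hL, hE⟩ := h.inv
  · obtain ⟨rfl, hl⟩ := List.cons.inj hL
    cases l with
    | nil => simp at hl; subst hl; exact Or.inl ⟨hxy, hn, rfl, hS, hE⟩
    | cons => simp at hl
  · obtain ⟨rfl, hl⟩ := List.cons.inj hL
    have hl' : l ++ [z] = (l₁ ++ d :: l₂) ++ [z'] := by simpa using hl
    obtain ⟨rfl, hz⟩ := List.append_inj' hl' rfl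
    simp at hz; subst hz
    exact Or.inr (Or.inl ⟨m, k, d, l₁, l₂, S₁, S₂, E₁, E₂, h₁, h₂, hS, hn, rfl, hS', hE⟩)
  · obtain ⟨rfl, hl⟩ := List.cons.inj hL
    obtain ⟨rfl, hz'⟩ := List.append_inj' hl rfl
    simp at hz'; subst hz'
    exact Or.inr (Or.inr ⟨m, c, E', hd, hz, hn, hE⟩)

theorem closing {n : ℕ} {x z : V} {l : List V} {S : Set V} {E : Set (Sym2 V)}
    (h : Disc n (x :: (l ++ [z])) S E) : s(z, x) ∈ E := by
  obtain ⟨-, -, -, -, rfl⟩ | ⟨m, k, d, l₁, l₂, S₁, S₂, E₁, E₂, -, -, -, -, -, -, rfl⟩ |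
    ⟨m, c, E', -, -, -, rfl⟩ := h.inv_cons_append
  · simp [Sym2.eq_swap]
  · simp
  · simp

theorem edge_of_append {n : ℕ} {a b : List V} {u w : V} {S : Set V} {E : Set (Sym2 V)}
    (h : Disc n (a ++ u :: w :: b) S E) : s(u, w) ∈ E := by
  have := h.isChain
  rw [List.isChain_append_cons_cons] at this
  exact this.2.1

theorem eq_of_pair {n : ℕ} {x y : V} {S : Set V} {E : Set (Sym2 V)} (h : Disc n [x, y] S E) :
    n = 1 ∧ S = {x, y} ∧ E = {s(x, y)} := by
  obtain ⟨-, hn, -, hS, hE⟩ | ⟨m, k, d, l₁, l₂, S₁, S₂, E₁, E₂, -, -, -, -, hl, -, -⟩ |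
    ⟨m, c, E', h', hE', -, -⟩ := inv_cons_append (l := []) h
  · exact ⟨hn, hS, hE⟩
  · simp at hl
  · exact absurd (by rw [Sym2.eq_swap]; exact h'.edge_of_append (a := [c]) (b := [])) hE'

theorem rotate_append_of {m : ℕ}
    (H : ∀ x l (S : Set V) E, Disc m (x :: l) S E → Disc m (l ++ [x]) S E)
    (a : List V) : ∀ (b : List V) (S : Set V) E, Disc m (a ++ b) S E → Disc m (b ++ a) S E := by
  induction a with
  | nil => simp
  | cons x a ih =>
    intro b S E h
    have := ih (b ++ [x]) S E (by simpa using H _ _ _ _ h)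
    simpa using this

theorem mem_singleton_of_inter {S₁ S₂ : Set V} {d : V} (hS : S₁ ∩ S₂ = {d}) {u : V}
    (h₁ : u ∈ S₁) (h₂ : u ∈ S₂) : u = d := by
  have : u ∈ S₁ ∩ S₂ := ⟨h₁, h₂⟩
  simpa [hS] using this

theorem rotate_join {m n : ℕ} {x z d : V} {l₁ l₂ : List V} {S₁ S₂ : Set V} {E₁ E₂ : Set (Sym2 V)}
    (IH : ∀ k < m + n + 1, ∀ x l (S : Set V) E, Disc k (x :: l) S E → Disc k (l ++ [x]) S E)
    (h₁ : Disc m (x :: (l₁ ++ [d])) S₁ E₁) (h₂ : Disc n (d :: (l₂ ++ [z])) S₂ E₂)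
    (hS : S₁ ∩ S₂ = {d}) :
    Disc (m + n + 1) (l₁ ++ d :: (l₂ ++ [z, x])) (S₁ ∪ S₂) (insert s(z, x) (E₁ ∪ E₂)) := by
  have hp₁ := h₁.pos
  have hp₂ := h₂.pos
  have hdS : d ∈ S₁ ∧ d ∈ S₂ := by
    have : d ∈ S₁ ∩ S₂ := by rw [hS]; rfl
    exact this
  have hxS : x ∈ S₁ := h₁.mem_of_mem x (by simp)
  have hzS : z ∈ S₂ := h₂.mem_of_mem z (by simp)
  have hxd : x ≠ d := by have := h₁.nodup; clear IH; grind
  have hzd : z ≠ d := by have := h₂.nodup; clear IH; grind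
  have hx₂ : x ∉ S₂ := fun h => hxd (mem_singleton_of_inter hS hxS h)
  have hz₁ : z ∉ S₁ := fun h => hzd (mem_singleton_of_inter hS h hzS)
  have hzx : z ≠ x := by grind
  cases l₁ with
  | nil =>
    obtain ⟨rfl, rfl, rfl⟩ := eq_of_pair h₁
    have := join (x := d) (l₁ := l₂) (l₂ := []) h₂ (edge hzx) (by clear IH; grind)
    refine this.congr (by omega) (by simp) (by clear IH; grind) ?_
    rw [Sym2.eq_swap (a := x) (b := d)]; clear IH; grind
  | cons h t =>
    have hhS : h ∈ S₁ := h₁.mem_of_mem h (by simp)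
    have r₁ := IH m (by omega) _ _ _ _ h₁
    have r₁' : Disc m (h :: ((t ++ [d]) ++ [x])) S₁ E₁ := by simpa using r₁
    obtain ⟨-, -, hl, -, -⟩ |
      ⟨m₁, m₂, d', t₁, t₂, A₁, A₂, F₁, F₂, g₁, g₂, hA, rfl, hl, rfl, rfl⟩ |
      ⟨m', c, E', g, hE', rfl, rfl⟩ := r₁'.inv_cons_append
    · simp at hl
    · have hd' : d' ∈ A₁ ∧ d' ∈ A₂ := by
        have : d' ∈ A₁ ∩ A₂ := by rw [hA]; rfl
        exact this
      have hxA₂ : x ∈ A₂ := g₂.mem_of_mem x (by simp)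
      obtain rfl | ⟨t₂, e, rfl⟩ := List.eq_nil_or_concat t₂
      · obtain ⟨rfl, hdd⟩ := List.append_inj' hl rfl
        simp at hdd; subst hdd
        obtain ⟨rfl, rfl, rfl⟩ := eq_of_pair g₂
        have j₁ := join (x := d) (l₁ := l₂) (l₂ := []) h₂ (edge hzx) (by clear IH; grind)
        have j₂ := join (l₂ := l₂ ++ [z]) g₁ (by simpa using j₁) (by clear IH; grind)
        refine j₂.congr (by omega) (by simp) (by clear IH; grind) ?_
        rw [Sym2.eq_swap (a := d) (b := x)]; clear IH; grind
      · have hl' : t ++ [d] = (t₁ ++ d' :: t₂) ++ [e] := by simpa using hl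
        obtain ⟨rfl, hdd⟩ := List.append_inj' hl' rfl
        simp at hdd; subst hdd
        have q₁ := rotate_append_of (IH m₂ (by omega)) (d' :: (t₂ ++ [d])) [x] _ _
          (by simpa using g₂)
        have hdA : d ∈ A₂ := g₂.mem_of_mem d (by simp)
        have q₂ := join (l₁ := d' :: t₂) (by simpa using q₁) h₂ (by clear IH; grind)
        have q₃ := IH _ (by omega) _ _ _ _ q₂
        have hint : A₁ ∩ (A₂ ∪ S₂) = {d'} := by
          refine Set.eq_singleton_iff_unique_mem.2 ⟨⟨hd'.1, Or.inl hd'.2⟩, ?_⟩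
          rintro u ⟨hu, hu' | hu'⟩
          · exact mem_singleton_of_inter hA hu hu'
          · obtain rfl := mem_singleton_of_inter hS (Or.inl hu) hu'
            exact mem_singleton_of_inter hA hu hdA
        have q₄ := join (l₂ := t₂ ++ d :: (l₂ ++ [z])) g₁ (by simpa using q₃) hint
        exact q₄.congr (by omega) (by simp) (by clear IH; grind) (by clear IH; grind)
    · have hh : h ≠ d := by have := h₁.nodup; clear IH; grind
      have hhz : h ≠ z := by clear IH; grind
      have q₁ := rotate_append_of (IH m' (by omega)) (c :: h :: (t ++ [d])) [x] _ _
        (by simpa using g)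
      have q₂ := join (l₁ := c :: h :: t) (by simpa using q₁) h₂ hS
      have q₃ := IH _ (by omega) _ _ _ _ q₂
      have hE₂ : s(x, h) ∉ E₂ := fun hh => hx₂ (h₂.edge_mem _ _ hh).1
      have q₄ := cover (x := h) (z := x) (c := c) (l := t ++ d :: (l₂ ++ [z])) (by simpa using q₃)
        (by clear IH; grind)
      exact q₄.congr (by omega) (by simp) (by clear IH; grind) (by clear IH; grind)

theorem rotate_cover {n : ℕ} {c x z : V} {l : List V} {S : Set V} {E : Set (Sym2 V)}
    (IH : ∀ k < n + 1, ∀ x l (S : Set V) E, Disc k (x :: l) S E → Disc k (l ++ [x]) S E)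
    (h₀ : Disc n (c :: x :: (l ++ [z])) S E) (hE : s(z, x) ∉ E) :
    Disc (n + 1) (l ++ [z, x]) S (insert s(z, x) E) := by
  have hzx : z ≠ x := by have := h₀.nodup; clear IH; grind
  cases l with
  | nil => exact absurd (by rw [Sym2.eq_swap]; exact h₀.edge_of_append (a := [c]) (b := [])) hE
  | cons h t =>
    have hhz : h ≠ z := by have := h₀.nodup; clear IH; grind
    have r := rotate_append_of (IH n (by omega)) [c, x] (h :: (t ++ [z])) _ _ (by simpa using h₀)
    have r' : Disc n (h :: ((t ++ [z, c]) ++ [x])) S E := by simpa using r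
    obtain ⟨-, -, hl, -, -⟩ |
      ⟨m₁, m₂, d', t₁, t₂, A₁, A₂, F₁, F₂, g₁, g₂, hA, rfl, hl, rfl, rfl⟩ |
      ⟨m', b, E', g, hE', rfl, rfl⟩ := r'.inv_cons_append
    · simp at hl
    · have hd' : d' ∈ A₁ ∧ d' ∈ A₂ := by
        have : d' ∈ A₁ ∩ A₂ := by rw [hA]; rfl
        exact this
      have hxA₂ : x ∈ A₂ := g₂.mem_of_mem x (by simp)
      have gp₁ := g₁.pos
      have gp₂ := g₂.pos
      obtain rfl | ⟨t₂, e, rfl⟩ := List.eq_nil_or_concat t₂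
      · obtain ⟨rfl, hdd⟩ := List.append_inj' (s₁ := t ++ [z]) (t₁ := [c]) (s₂ := t₁) (t₂ := [d']) (by simpa using hl) rfl
        simp at hdd; subst hdd
        obtain ⟨rfl, rfl, rfl⟩ := eq_of_pair g₂
        have q₁ := rotate_append_of (IH m₁ (by omega)) (h :: (t ++ [z])) [c] _ _
          (by simpa using g₁)
        have hxc : x ≠ c := by have := h₀.nodup; clear IH; grind
        have hhc : h ≠ c := by have := h₀.nodup; clear IH; grind
        have q₂ := join (x := x) (l₁ := []) (l₂ := h :: t) (edge hxc) (by simpa using q₁) (by clear IH; grind)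
        have q₃ := IH _ (by omega) _ _ _ _ q₂
        have hF : s(x, h) ∉ F₁ := fun hh =>
          hxc (mem_singleton_of_inter hA (g₁.edge_mem _ _ hh).1 hxA₂)
        have q₄ := cover (x := h) (z := x) (c := c) (l := t ++ [z]) (by simpa using q₃)
          (by clear IH; grind)
        refine q₄.congr (by omega) (by simp) (by clear IH; grind) ?_
        rw [Sym2.eq_swap (a := c) (b := x)]; clear IH; grind
      · obtain ⟨hl', hdd⟩ := List.append_inj' (s₁ := t ++ [z]) (t₁ := [c])
          (s₂ := t₁ ++ d' :: t₂) (t₂ := [e]) (by simpa using hl) rfl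
        simp at hdd; subst hdd
        obtain rfl | ⟨t₂, e, rfl⟩ := List.eq_nil_or_concat t₂
        · obtain ⟨rfl, hdd⟩ := List.append_inj' hl' rfl
          simp at hdd; subst hdd
          have := closing (l := [c]) (by simpa using g₂)
          rw [Sym2.eq_swap] at this
          grind
        · obtain ⟨rfl, hdd⟩ := List.append_inj' (s₁ := t) (t₁ := [z])
            (s₂ := t₁ ++ d' :: t₂) (t₂ := [e]) (by simpa using hl') rfl
          simp at hdd; subst hdd
          have q₁ := rotate_append_of (IH m₂ (by omega)) (d' :: (t₂ ++ [z])) [c, x] _ _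
            (by simpa using g₂)
          have q₂ := cover (c := c) (x := x) (z := z) (l := d' :: t₂) (by simpa using q₁) (by clear IH; grind)
          have q₃ := IH _ (by omega) _ _ _ _ q₂
          have q₄ := join (l₂ := t₂ ++ [z]) g₁ (by simpa using q₃) (by clear IH; grind)
          exact q₄.congr (by omega) (by simp) (by clear IH; grind) (by clear IH; grind)
    · have q₁ := rotate_append_of (IH m' (by omega)) (b :: h :: (t ++ [z])) [c, x] _ _
        (by simpa using g)
      have q₂ := cover (c := c) (x := x) (z := z) (l := b :: h :: t) (by simpa using q₁) (by clear IH; grind)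
      have q₃ := IH _ (by omega) _ _ _ _ q₂
      have q₄ := cover (x := h) (z := x) (c := b) (l := t ++ [z]) (by simpa using q₃) (by clear IH; grind)
      exact q₄.congr (by omega) (by simp) rfl (by clear IH; grind)

theorem rotate_cons (n : ℕ) : ∀ (x : V) (l : List V) (S : Set V) (E : Set (Sym2 V)),
    Disc n (x :: l) S E → Disc n (l ++ [x]) S E := by
  induction n using Nat.strong_induction_on with
  | _ n IH =>
    intro x l S E h
    obtain ⟨x', y', hxy, rfl, hL, rfl, rfl⟩ |
      ⟨m, k, x', z', d, l₁, l₂, S₁, S₂, E₁, E₂, h₁, h₂, hS, rfl, hL, rfl, rfl⟩ |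
      ⟨m, c, x', z', l', E', hd, hz, rfl, hL, rfl⟩ := h.inv
    · obtain ⟨rfl, rfl⟩ := List.cons.inj hL
      exact (edge hxy.symm).congr rfl rfl (Set.pair_comm _ _) (by rw [Sym2.eq_swap])
    · obtain ⟨rfl, rfl⟩ := List.cons.inj hL
      simpa using rotate_join IH h₁ h₂ hS
    · obtain ⟨rfl, rfl⟩ := List.cons.inj hL
      simpa using rotate_cover IH hd hz

theorem rotate {n : ℕ} {a b : List V} {S : Set V} {E : Set (Sym2 V)} (h : Disc n (a ++ b) S E) :
    Disc n (b ++ a) S E :=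
  rotate_append_of (rotate_cons n) a b S E h

theorem insert_vertex {n : ℕ} {l₁ l₂ : List V} {u v w : V} {S : Set V} {E : Set (Sym2 V)}
    (h : Disc n (l₁ ++ u :: w :: l₂) S E) (hv : v ∉ S) :
    Disc (n + 2) (l₁ ++ u :: v :: w :: l₂) (insert v S) (insert s(u, v) (insert s(v, w) E)) := by
  have hu : u ∈ S := h.mem_of_mem u (by simp)
  have r := rotate (a := l₁ ++ [u]) (b := w :: l₂) (by simpa using h)
  have huv : u ≠ v := by rintro rfl; exact hv hu
  have j := join (x := w) (l₁ := l₂ ++ l₁) (l₂ := []) (by simpa using r) (edge huv) (by grind)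
  have r' := rotate (a := w :: l₂) (b := l₁ ++ [u, v]) (by simpa using j)
  exact r'.congr (by omega) (by simp) (by grind) (by grind)

theorem cover_vertex {n : ℕ} {l₁ l₂ : List V} {u v w : V} {S : Set V} {E : Set (Sym2 V)}
    (h : Disc n (l₁ ++ u :: v :: w :: l₂) S E) (hE : s(u, w) ∉ E) :
    Disc (n + 1) (l₁ ++ u :: w :: l₂) S (insert s(u, w) E) := by
  have r := rotate (a := l₁ ++ [u]) (b := v :: w :: l₂) (by simpa using h)
  have j := cover (c := v) (x := w) (z := u) (l := l₂ ++ l₁) (by simpa using r) hE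
  have r' := rotate (a := w :: l₂) (b := l₁ ++ [u]) (by simpa using j)
  exact r'.congr (by omega) (by simp) rfl rfl

theorem noncrossing {n : ℕ} {L : List V} {S : Set V} {E : Set (Sym2 V)} (h : Disc n L S E) :
    ∀ f : V → ℤ, L.Pairwise (fun u w => f u < f w) → ∀ p ∈ L, ∀ q ∈ L, ∀ r ∈ L, ∀ s ∈ L,
      f p < f q → f q < f r → f r < f s → s(p, r) ∈ E → s(q, s) ∉ E := by
  induction h with
  | @edge x y hxy =>
    intro f hf p hp q hq r hr s hs h1 h2 h3
    simp only [List.mem_cons, List.not_mem_nil, or_false] at hp hq hr hs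
    rcases hp with rfl | rfl <;> rcases hq with rfl | rfl <;> rcases hr with rfl | rfl <;> omega
  | @join m n x z d l₁ l₂ S₁ S₂ E₁ E₂ h₁ h₂ hS ih₁ ih₂ =>
    intro f hf p hp q hq r hr s hs h1 h2 h3 hpr hqs
    have e : x :: (l₁ ++ d :: (l₂ ++ [z])) = (x :: l₁) ++ (d :: (l₂ ++ [z])) := by simp
    have hf' := List.pairwise_append.1 (e ▸ hf)
    have f₁ : (x :: (l₁ ++ [d])).Pairwise (fun u w => f u < f w) := by
      refine hf.sublist ?_
      simp
    have f₂ : (d :: (l₂ ++ [z])).Pairwise (fun u w => f u < f w) := hf'.2.1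
    have hx : ∀ v ∈ x :: (l₁ ++ d :: (l₂ ++ [z])), f x ≤ f v := by
      intro v hv
      rcases List.mem_cons.1 hv with rfl | hv
      · exact le_rfl
      · exact (List.rel_of_pairwise_cons hf hv).le
    have hd₂ : ∀ v ∈ d :: (l₂ ++ [z]), f d ≤ f v := by
      intro v hv
      rcases List.mem_cons.1 hv with rfl | hv
      · exact le_rfl
      · exact (List.rel_of_pairwise_cons f₂ hv).le
    have hz : ∀ v ∈ x :: (l₁ ++ d :: (l₂ ++ [z])), f v ≤ f z := by
      intro v hv
      have e' : x :: (l₁ ++ d :: (l₂ ++ [z])) = (x :: (l₁ ++ d :: l₂)) ++ [z] := by simp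
      rw [e'] at hv hf
      rcases List.mem_append.1 hv with hv | hv
      · exact ((List.pairwise_append.1 hf).2.2 v hv z (by simp)).le
      · simp at hv; simp [hv]
    have hL : ∀ v ∈ x :: (l₁ ++ d :: (l₂ ++ [z])),
        (v ∈ S₁ → f v ≤ f d ∧ v ∈ x :: (l₁ ++ [d])) ∧
        (v ∈ S₂ → f d ≤ f v ∧ v ∈ d :: (l₂ ++ [z])) := by
      intro v hv
      rw [e] at hv
      rcases List.mem_append.1 hv with hv' | hv'
      · have hvd := hf'.2.2 v hv' d (by simp)
        have hv₁ : v ∈ x :: (l₁ ++ [d]) := by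
          rw [← List.cons_append]; exact List.mem_append_left _ hv'
        refine ⟨fun _ => ⟨hvd.le, hv₁⟩, fun hv₂ => ?_⟩
        obtain rfl := mem_singleton_of_inter hS (h₁.mem_of_mem v hv₁) hv₂
        omega
      · refine ⟨fun hv₁ => ?_, fun _ => ⟨hd₂ v hv', hv'⟩⟩
        obtain rfl := mem_singleton_of_inter hS hv₁ (h₂.mem_of_mem v hv')
        simp
    have hxp := hx p hp
    have hxq := hx q hq
    have hzr := hz r hr
    have hzs := hz s hs
    rcases hpr with hpr | hpr | hpr
    · rcases Sym2.eq_iff.1 hpr with ⟨rfl, rfl⟩ | ⟨rfl, rfl⟩ <;> omega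
    · obtain ⟨hp₁, hr₁⟩ := h₁.edge_mem _ _ hpr
      rcases hqs with hqs | hqs | hqs
      · rcases Sym2.eq_iff.1 hqs with ⟨rfl, rfl⟩ | ⟨rfl, rfl⟩ <;> omega
      · obtain ⟨hq₁, hs₁⟩ := h₁.edge_mem _ _ hqs
        exact ih₁ f f₁ p ((hL p hp).1 hp₁).2 q ((hL q hq).1 hq₁).2 r ((hL r hr).1 hr₁).2
          s ((hL s hs).1 hs₁).2 h1 h2 h3 hpr hqs
      · obtain ⟨hq₁, hs₁⟩ := h₂.edge_mem _ _ hqs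
        have := ((hL r hr).1 hr₁).1
        have := ((hL q hq).2 hq₁).1
        omega
    · obtain ⟨hp₁, hr₁⟩ := h₂.edge_mem _ _ hpr
      rcases hqs with hqs | hqs | hqs
      · rcases Sym2.eq_iff.1 hqs with ⟨rfl, rfl⟩ | ⟨rfl, rfl⟩ <;> omega
      · obtain ⟨hq₁, hs₁⟩ := h₁.edge_mem _ _ hqs
        have := ((hL p hp).2 hp₁).1
        have := ((hL s hs).1 hs₁).1
        omega
      · obtain ⟨hq₁, hs₁⟩ := h₂.edge_mem _ _ hqs
        exact ih₂ f f₂ p ((hL p hp).2 hp₁).2 q ((hL q hq).2 hq₁).2 r ((hL r hr).2 hr₁).2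
          s ((hL s hs).2 hs₁).2 h1 h2 h3 hpr hqs
  | @cover n c x z l S E h hE ih =>
    intro f hf p hp q hq r hr s hs h1 h2 h3 hpr hqs
    have hc : c ∉ x :: (l ++ [z]) := (List.nodup_cons.1 h.nodup).1
    have hx : ∀ v ∈ x :: (l ++ [z]), f x ≤ f v := by
      intro v hv
      rcases List.mem_cons.1 hv with rfl | hv
      · exact le_rfl
      · exact (List.rel_of_pairwise_cons hf hv).le
    have hz : ∀ v ∈ x :: (l ++ [z]), f v ≤ f z := by
      intro v hv
      rw [← List.cons_append] at hv hf
      rcases List.mem_append.1 hv with hv | hv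
      · exact ((List.pairwise_append.1 hf).2.2 v hv z (by simp)).le
      · simp at hv; simp [hv]
    have hxp := hx p hp
    have hxq := hx q hq
    have hzr := hz r hr
    have hzs := hz s hs
    rcases hpr with hpr | hpr
    · rcases Sym2.eq_iff.1 hpr with ⟨rfl, rfl⟩ | ⟨rfl, rfl⟩ <;> omega
    rcases hqs with hqs | hqs
    · rcases Sym2.eq_iff.1 hqs with ⟨rfl, rfl⟩ | ⟨rfl, rfl⟩ <;> omega
    classical
    have hg : ∀ v ∈ x :: (l ++ [z]), Function.update f c (f x - 1) v = f v := fun v hv =>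
      Function.update_of_ne (by rintro rfl; exact hc hv) _ _
    refine ih (Function.update f c (f x - 1)) ?_ p (List.mem_cons_of_mem _ hp) q
      (List.mem_cons_of_mem _ hq) r (List.mem_cons_of_mem _ hr) s (List.mem_cons_of_mem _ hs)
      ?_ ?_ ?_ hpr hqs
    · refine List.pairwise_cons.2 ⟨fun v hv => ?_, ?_⟩
      · rw [hg v hv, Function.update_self]
        have := hx v hv
        omega
      · refine hf.imp_of_mem fun ha hb hab => ?_
        rwa [hg _ ha, hg _ hb]
    · rwa [hg p hp, hg q hq]
    · rwa [hg q hq, hg r hr]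
    · rwa [hg r hr, hg s hs]

theorem exists_rank {L : List V} (h : L.Nodup) :
    ∃ f : V → ℤ, L.Pairwise (fun u w => f u < f w) := by
  classical
  refine ⟨fun v => L.idxOf v, List.pairwise_iff_getElem.2 fun i j hi hj hij => ?_⟩
  simp [h.idxOf_getElem, hij]

theorem exists_cover_segment : ∀ (N n : ℕ) (m l₁ l₂ : List V) (s t : V) (S : Set V)
    (E : Set (Sym2 V)), m.length = N → Disc n (l₁ ++ s :: (m ++ t :: l₂)) S E → m ≠ [] →
    s(s, t) ∉ E → ∃ n' E', E ⊆ E' ∧ s(s, t) ∈ E' ∧ Disc n' (l₁ ++ s :: t :: l₂) S E' := by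
  intro N
  induction N with
  | zero =>
    intro n m l₁ l₂ s t S E hm h hm' hE
    exact absurd (List.eq_nil_of_length_eq_zero hm) hm'
  | succ N ih =>
    intro n m l₁ l₂ s t S E hm h hm' hE
    have hn := h.nodup
    match m, hm, h, hn with
    | [p], _, h, hn =>
      exact ⟨_, _, Set.subset_insert _ _, Set.mem_insert _ _, h.cover_vertex hE⟩
    | p :: p₂ :: m, hm, h, hn =>
      by_cases h2 : s(s, p₂) ∈ E
      · obtain ⟨p₃, m', hp₃⟩ : ∃ p₃ m', m ++ t :: l₂ = p₃ :: m' := by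
          cases m <;> simp
        have e₁ : l₁ ++ s :: (p :: p₂ :: m ++ t :: l₂) = (l₁ ++ [s]) ++ p :: p₂ :: p₃ :: m' := by
          simp [hp₃]
        have hp : s(p, p₃) ∉ E := by
          obtain ⟨f, hf⟩ := exists_rank hn
          have hf' := hf
          rw [e₁] at hf'
          have hs : [s, p, p₂, p₃].Sublist ((l₁ ++ [s]) ++ p :: p₂ :: p₃ :: m') := by simp
          have hf'' := hf'.sublist hs
          have hs' := hs.subset
          rw [← e₁] at hs'
          simp only [List.pairwise_cons, List.mem_cons, List.not_mem_nil, or_false] at hf''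
          exact h.noncrossing f hf s (hs' (by simp)) p (hs' (by simp)) p₂ (hs' (by simp)) p₃
            (hs' (by simp)) (by grind) (by grind) (by grind) h2
        have c := cover_vertex (l₁ := l₁ ++ [s]) (u := p) (v := p₂) (w := p₃) (l₂ := m')
          (by simpa [hp₃] using h) hp
        have hsp : s ≠ p := by grind
        have hsp₃ : s ≠ p₃ := by grind
        obtain ⟨n', E', hEE, hE', hd⟩ := ih _ (p :: m) l₁ l₂ s t S _ (by simpa using hm)
          (by simpa [← hp₃] using c) (by simp) (by
            rintro (hh | hh)
            · rcases Sym2.eq_iff.1 hh with ⟨rfl, rfl⟩ | ⟨rfl, rfl⟩ <;> contradiction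
            · exact hE hh)
        exact ⟨n', E', (Set.subset_insert _ _).trans hEE, hE', hd⟩
      · have c := cover_vertex (l₁ := l₁) (u := s) (v := p) (w := p₂) (l₂ := m ++ t :: l₂)
          (by simpa using h) h2
        have hpt : t ≠ p₂ := by grind
        have hst : s ≠ t := by grind
        obtain ⟨n', E', hEE, hE', hd⟩ := ih _ (p₂ :: m) l₁ l₂ s t S _ (by simpa using hm)
          (by simpa using c) (by simp) (by
            rintro (hh | hh)
            · rcases Sym2.eq_iff.1 hh with ⟨_, rfl⟩ | ⟨_, rfl⟩ <;> contradiction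
            · exact hE hh)
        exact ⟨n', E', (Set.subset_insert _ _).trans hEE, hE', hd⟩

end Disc

/-- Witnesses for a Schnyder-type drawing of a graph with vertex set `S`, edge set `E` and upper
contour `L`: the coordinate functions `A`, `B` and the position `r` below the contour. -/
structure IsSchnyder {V : Type*} (L : List V) (S : Set V) (E : Set (Sym2 V)) (A B : V → ℤ)
    (r : V → ℚ) : Prop where
  contour : L.Pairwise (fun a b => r a < r b ∧ A a < A b ∧ B b < B a)
  contour_mem : ∀ c ∈ L, c ∈ S
  proj : ∀ w ∈ S, ∃ c ∈ L, r w = r c ∧ (w = c ∨ (A c < A w ∧ B c < B w))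
  edge : ∀ s t, s(s, t) ∈ E → s ∈ S ∧ t ∈ S ∧ s ≠ t ∧ (r s < r t → A s < A t ∧ B t < B s)
  empty : ∀ s t w, s(s, t) ∈ E → w ∈ S → w ≠ s → w ≠ t →
    (A s < A w ∧ A t < A w ∧ r s ≤ r w ∧ r t ≤ r w) ∨
    (B s < B w ∧ B t < B w ∧ r w ≤ r s ∧ r w ≤ r t) ∨
    (A w + B w < A s + B s ∧ A w + B w < A t + B t)
  bound : ∀ w ∈ S, 0 ≤ A w ∧ A w ≤ 2 * S.ncard ∧ 0 ≤ B w ∧ B w ≤ 2 * S.ncard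

namespace IsSchnyder

variable {V : Type*}

theorem mono {L : List V} {S : Set V} {E E' : Set (Sym2 V)} {A B : V → ℤ} {r : V → ℚ}
    (h : IsSchnyder L S E A B r) (hE : E' ⊆ E) : IsSchnyder L S E' A B r where
  contour := h.contour
  contour_mem := h.contour_mem
  proj := h.proj
  edge s t hst := h.edge s t (hE hst)
  empty s t w hst := h.empty s t w (hE hst)
  bound := h.bound

theorem pair {x y : V} (hxy : x ≠ y) : ∃ A B r, IsSchnyder [x, y] {x, y} ∅ A B r := by
  classical
  refine ⟨fun v => if v = x then 0 else 1, fun v => if v = x then 1 else 0,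
    fun v => if v = x then 0 else 1, ?_, ?_, ?_, ?_, ?_, ?_⟩
  · simp [hxy.symm]
  · simp
  · rintro w (rfl | rfl)
    · exact ⟨w, by simp⟩
    · exact ⟨w, by simp⟩
  · simp
  · simp
  · intro w _
    rw [Set.ncard_pair hxy]
    split_ifs <;> norm_num

theorem trichotomy {L : List V} {S : Set V} {E : Set (Sym2 V)} {A B : V → ℤ} {r : V → ℚ}
    (h : IsSchnyder L S E A B r) {a b : V} (ha : a ∈ L) (hb : b ∈ L) :
    (r a < r b ∧ A a < A b ∧ B b < B a) ∨ a = b ∨ (r b < r a ∧ A b < A a ∧ B a < B b) := by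
  by_cases hab : a = b
  · exact Or.inr (Or.inl hab)
  · have hs : Std.Symm (fun a b => (r a < r b ∧ A a < A b ∧ B b < B a) ∨
        (r b < r a ∧ A b < A a ∧ B a < B b)) := ⟨fun a b h => h.symm⟩
    have := (h.contour.imp (S := fun a b => (r a < r b ∧ A a < A b ∧ B b < B a) ∨
      (r b < r a ∧ A b < A a ∧ B a < B b)) (fun h => Or.inl h)).forall ha hb hab
    tauto

theorem add_edge {l₁ l₂ : List V} {x y : V} {S : Set V} {E : Set (Sym2 V)} {A B : V → ℤ}
    {r : V → ℚ} (h : IsSchnyder (l₁ ++ x :: y :: l₂) S E A B r) :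
    IsSchnyder (l₁ ++ x :: y :: l₂) S (insert s(x, y) E) A B r := by
  have hx : x ∈ l₁ ++ x :: y :: l₂ := by simp
  have hy : y ∈ l₁ ++ x :: y :: l₂ := by simp
  have hc := List.pairwise_append.1 h.contour
  have hc₂ := List.pairwise_cons.1 hc.2.1
  have hc₃ := List.pairwise_cons.1 hc₂.2
  have hxy := hc₂.1 y (by simp)
  have key : ∀ c ∈ l₁ ++ x :: y :: l₂, r c < r x ∨ c = x ∨ c = y ∨ r y < r c := by
    intro c hc'
    simp only [List.mem_append, List.mem_cons] at hc'
    rcases hc' with hc' | rfl | rfl | hc'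
    · exact Or.inl (hc.2.2 c hc' x (by simp)).1
    · simp
    · simp
    · exact Or.inr (Or.inr (Or.inr (hc₃.1 c hc').1))
  have hempty : ∀ w, w ∈ S → w ≠ x → w ≠ y →
      (A x < A w ∧ A y < A w ∧ r x ≤ r w ∧ r y ≤ r w) ∨
      (B x < B w ∧ B y < B w ∧ r w ≤ r x ∧ r w ≤ r y) := by
    intro w hw hwx hwy
    obtain ⟨c, hcL, hrc, hwc⟩ := h.proj w hw
    have t₁ := h.trichotomy hcL hx
    have t₂ := h.trichotomy hcL hy
    have k := key c hcL
    rw [hrc]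
    grind
  refine ⟨h.contour, h.contour_mem, h.proj, ?_, ?_, h.bound⟩
  · rintro s t (hst | hst)
    · rcases Sym2.eq_iff.1 hst with ⟨rfl, rfl⟩ | ⟨rfl, rfl⟩
      · exact ⟨h.contour_mem _ hx, h.contour_mem _ hy, by rintro rfl; exact lt_irrefl _ hxy.1,
          fun _ => hxy.2⟩
      · exact ⟨h.contour_mem _ hy, h.contour_mem _ hx, by rintro rfl; exact lt_irrefl _ hxy.1,
          fun hlt => absurd hlt hxy.1.not_gt⟩
    · exact h.edge s t hst
  · rintro s t w (hst | hst) hw hws hwt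
    · rcases Sym2.eq_iff.1 hst with ⟨rfl, rfl⟩ | ⟨rfl, rfl⟩
      · have := hempty w hw hws hwt
        tauto
      · have := hempty w hw hwt hws
        tauto
    · exact h.empty s t w hst hw hws hwt

set_option maxHeartbeats 1600000 in
theorem insert_vertex [Finite V] {l₁ l₂ m : List V} {p q v : V} {S : Set V} {E : Set (Sym2 V)}
    {A B : V → ℤ} {r : V → ℚ} (h : IsSchnyder (l₁ ++ p :: (m ++ q :: l₂)) S E A B r)
    (hv : v ∉ S) : ∃ A' B' r', IsSchnyder (l₁ ++ p :: v :: q :: l₂) (insert v S)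
      (E ∪ {e | ∃ i ∈ p :: (m ++ [q]), e = s(v, i)}) A' B' r' := by
  classical
  set L := l₁ ++ p :: (m ++ q :: l₂) with hL
  have hp : p ∈ L := by simp [hL]
  have hq : q ∈ L := by simp [hL]
  have hc := List.pairwise_append.1 h.contour
  have hc₂ := List.pairwise_cons.1 hc.2.1
  have hc₃ := List.pairwise_append.1 hc₂.2
  have hc₄ := List.pairwise_cons.1 hc₃.2.1
  have hpq := hc₂.1 q (by simp)
  have hl₁ : ∀ c ∈ l₁, r c < r p ∧ A c < A p ∧ B p < B c := fun c hcl => hc.2.2 c hcl p (by simp)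
  have hl₂ : ∀ c ∈ l₂, r q < r c ∧ A q < A c ∧ B c < B q := hc₄.1
  have hm : ∀ i ∈ p :: (m ++ [q]), i ∈ L ∧ r p ≤ r i ∧ r i ≤ r q := by
    intro i hi
    simp only [List.mem_cons, List.mem_append, List.not_mem_nil, or_false] at hi
    rcases hi with rfl | hi | rfl
    · exact ⟨hp, le_rfl, hpq.1.le⟩
    · exact ⟨by simp [hL, hi], (hc₂.1 i (by simp [hi])).1.le, (hc₃.2.2 i hi q (by simp)).1.le⟩
    · exact ⟨hq, hpq.1.le, le_rfl⟩
  have hmid₁ : r p < (r p + r q) / 2 := by linarith [hpq.1]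
  have hmid₂ : (r p + r q) / 2 < r q := by linarith [hpq.1]
  set μ := (r p + r q) / 2 with hμ
  let cls : V → ℤ := fun w => if r w ≤ r p then 0 else if r w < r q then 1 else 2
  let A' : V → ℤ := fun w => if w = v then A p + 1 else A w + cls w
  let B' : V → ℤ := fun w => if w = v then B q + 1 else B w + (2 - cls w)
  let r' : V → ℚ := fun w => if w = v then μ else
    if r w ≤ r p then r w else if r w < r q then μ else r w
  have hA'v : A' v = A p + 1 := if_pos rfl
  have hB'v : B' v = B q + 1 := if_pos rfl
  have hr'v : r' v = μ := if_pos rfl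
  have hne : ∀ w ∈ S, w ≠ v := fun w hw => by rintro rfl; exact hv hw
  have hcase : ∀ w ∈ S, (r w ≤ r p ∧ A' w = A w ∧ B' w = B w + 2 ∧ r' w = r w) ∨
      (r p < r w ∧ r w < r q ∧ A' w = A w + 1 ∧ B' w = B w + 1 ∧ r' w = μ) ∨
      (r q ≤ r w ∧ A' w = A w + 2 ∧ B' w = B w ∧ r' w = r w) := by
    intro w hw
    have := hne w hw
    by_cases h₁ : r w ≤ r p
    · left; simp [A', B', r', cls, this, h₁]
    · by_cases h₂ : r w < r q
      · right; left
        refine ⟨not_le.1 h₁, h₂, ?_, ?_, ?_⟩ <;> simp [A', B', r', cls, this, h₁, h₂]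
      · right; right
        refine ⟨not_lt.1 h₂, ?_, ?_, ?_⟩ <;> simp [A', B', r', cls, this, h₁, h₂]
  clear_value A' B' r' μ
  clear cls
  have hmono : ∀ w ∈ S, ∀ u ∈ S, r w ≤ r u →
      A' w - A w ≤ A' u - A u ∧ B' u - B u ≤ B' w - B w ∧ r' w ≤ r' u := by
    intro w hw u hu hwu
    have h1 := hcase w hw
    have h2 := hcase u hu
    rcases h1 with h1 | h1 | h1 <;> rcases h2 with h2 | h2 | h2 <;>
      refine ⟨?_, ?_, ?_⟩ <;> first | omega | linarith
  have hsum : ∀ w ∈ S, A' w + B' w = A w + B w + 2 := by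
    intro w hw
    rcases hcase w hw with h1 | h1 | h1 <;> omega
  have hmem : ∀ c ∈ L, c ∈ S := h.contour_mem
  have hpS := hmem p hp
  have hqS := hmem q hq
  have hvp : A' p < A' v ∧ B' v < B' p ∧ r' p < r' v := by
    rcases hcase p hpS with h1 | h1 | h1
    · refine ⟨by omega, by omega, by rw [hr'v]; linarith⟩
    · exact absurd h1.1 (lt_irrefl _)
    · linarith
  have hvq : A' v < A' q ∧ B' q < B' v ∧ r' v < r' q := by
    rcases hcase q hqS with h1 | h1 | h1
    · linarith
    · exact absurd h1.2.1 (lt_irrefl _)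
    · refine ⟨by omega, by omega, by rw [hr'v]; linarith⟩
  have hlt : ∀ a ∈ L, ∀ b ∈ L, (r a ≤ r p ∨ r q ≤ r b) → r a < r b ∧ A a < A b ∧ B b < B a →
      r' a < r' b ∧ A' a < A' b ∧ B' b < B' a := by
    intro a ha b hb hab hlt
    have h1 := hcase a (hmem a ha)
    have h2 := hcase b (hmem b hb)
    have h3 := hmono a (hmem a ha) b (hmem b hb) hlt.1.le
    refine ⟨?_, by omega, by omega⟩
    rcases h1 with h1 | h1 | h1 <;> rcases h2 with h2 | h2 | h2 <;>
      rcases hab with hab | hab <;> linarith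
  have hnew : ∀ i ∈ p :: (m ++ [q]), ∀ w ∈ S, w ≠ i →
      (A' v < A' w ∧ A' i < A' w ∧ r' v ≤ r' w ∧ r' i ≤ r' w) ∨
      (B' v < B' w ∧ B' i < B' w ∧ r' w ≤ r' v ∧ r' w ≤ r' i) := by
    intro i hi w hw hwi
    obtain ⟨hiL, hpi, hiq⟩ := hm i hi
    obtain ⟨c, hcL, hrc, hwc⟩ := h.proj w hw
    have hAB : A c ≤ A w ∧ B c ≤ B w := by
      rcases hwc with rfl | hwc
      · simp
      · exact ⟨hwc.1.le, hwc.2.le⟩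
    have hiS := hmem i hiL
    rcases h.trichotomy hcL hiL with hci | rfl | hic
    · right
      have h3 := hmono w hw i hiS (by rw [hrc]; exact hci.1.le)
      have hcq : B q < B c := by
        rcases h.trichotomy hcL hq with t | rfl | t
        · exact t.2.2
        · exact absurd hci.1 (not_lt.2 hiq)
        · linarith
      have h1 := hcase w hw
      refine ⟨?_, by omega, ?_, h3.2.2⟩
      · rw [hB'v]; rcases h1 with h1 | h1 | h1
        · omega
        · omega
        · linarith
      · rw [hr'v]; rcases h1 with h1 | h1 | h1 <;> linarith
    · have hwc' := hwc.resolve_left hwi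
      have h1 := hcase w hw
      have h4 := hmono w hw c hiS hrc.le
      have h3 := hmono c hiS w hw hrc.ge
      rcases h.trichotomy hcL hq with t | rfl | t
      · right
        refine ⟨?_, by omega, ?_, h4.2.2⟩
        · rw [hB'v]; rcases h1 with h1 | h1 | h1
          · omega
          · omega
          · linarith
        · rw [hr'v]; rcases h1 with h1 | h1 | h1 <;> linarith
      · left
        refine ⟨?_, by omega, ?_, h3.2.2⟩
        · rw [hA'v]; rcases h1 with h1 | h1 | h1
          · linarith
          · omega
          · omega
        · rw [hr'v]; rcases h1 with h1 | h1 | h1 <;> linarith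
      · linarith
    · left
      have h3 := hmono i hiS w hw (by rw [hrc]; exact hic.1.le)
      have hcp : A p < A c := by
        rcases h.trichotomy hcL hp with t | rfl | t
        · linarith
        · exact absurd hic.1 (not_lt.2 hpi)
        · exact t.2.1
      have h1 := hcase w hw
      refine ⟨?_, by omega, ?_, h3.2.2⟩
      · rw [hA'v]; rcases h1 with h1 | h1 | h1
        · linarith
        · omega
        · omega
      · rw [hr'v]; rcases h1 with h1 | h1 | h1 <;> linarith
  have hleft : ∀ s t, s(s, t) ∈ E → r s < r p →
      (A' s < A' v ∧ A' t < A' v ∧ r' s ≤ r' v ∧ r' t ≤ r' v) ∨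
      (B' s < B' v ∧ B' t < B' v ∧ r' v ≤ r' s ∧ r' v ≤ r' t) ∨
      (A' v + B' v < A' s + B' s ∧ A' v + B' v < A' t + B' t) := by
    intro s t hst hs
    obtain ⟨hsS, htS, hne, hst'⟩ := h.edge s t hst
    have h1 := hmono s hsS p hpS hs.le
    by_cases htp : t = p
    · subst htp
      have := hst' hs
      left
      exact ⟨by omega, hvp.1, by linarith, hvp.2.2.le⟩
    · rcases h.empty s t p hst hpS (by rintro rfl; exact lt_irrefl _ hs) (Ne.symm htp) with
        h2 | h2 | h2
      · left
        have h3 := hmono t htS p hpS h2.2.2.2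
        exact ⟨by omega, by omega, by linarith, by linarith⟩
      · linarith
      · right; right
        rw [hsum s hsS, hsum t htS]
        omega
  have hright : ∀ s t, s(s, t) ∈ E → r q < r s →
      (A' s < A' v ∧ A' t < A' v ∧ r' s ≤ r' v ∧ r' t ≤ r' v) ∨
      (B' s < B' v ∧ B' t < B' v ∧ r' v ≤ r' s ∧ r' v ≤ r' t) ∨
      (A' v + B' v < A' s + B' s ∧ A' v + B' v < A' t + B' t) := by
    intro s t hst hs
    obtain ⟨hsS, htS, hne, -⟩ := h.edge s t hst
    obtain ⟨-, -, -, hst'⟩ := h.edge t s (by rwa [Sym2.eq_swap])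
    have h1 := hmono q hqS s hsS hs.le
    by_cases htq : t = q
    · subst htq
      have := hst' hs
      right; left
      exact ⟨by omega, hvq.2.1, by linarith, hvq.2.2.le⟩
    · rcases h.empty s t q hst hqS (by rintro rfl; exact lt_irrefl _ hs) (Ne.symm htq) with
        h2 | h2 | h2
      · linarith
      · right; left
        have h3 := hmono q hqS t htS h2.2.2.2
        exact ⟨by omega, by omega, by linarith, by linarith⟩
      · right; right
        rw [hsum s hsS, hsum t htS]
        omega
  have hinner : ∀ s ∈ S, r p ≤ r s → r s ≤ r q → A' v + B' v < A' s + B' s := by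
    intro s hs h1 h2
    rw [hsum s hs]
    obtain ⟨c, hcL, hrc, hwc⟩ := h.proj s hs
    have t₁ := h.trichotomy hcL hp
    have t₂ := h.trichotomy hcL hq
    rw [hrc] at h1 h2
    have h3 : A p ≤ A c ∧ B q ≤ B c ∧ A p + B q < A c + B c := by
      rcases t₁ with t₁ | rfl | t₁ <;> rcases t₂ with t₂ | rfl | t₂ <;> first | linarith | omega
    rcases hwc with rfl | hwc <;> omega
  have hsym : ∀ s t, s(s, t) ∈ E → 
      (A' s < A' v ∧ A' t < A' v ∧ r' s ≤ r' v ∧ r' t ≤ r' v) ∨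
      (B' s < B' v ∧ B' t < B' v ∧ r' v ≤ r' s ∧ r' v ≤ r' t) ∨
      (A' v + B' v < A' s + B' s ∧ A' v + B' v < A' t + B' t) := by
    intro s t hst
    obtain ⟨hsS, htS, hne, -⟩ := h.edge s t hst
    have hts : s(t, s) ∈ E := by rwa [Sym2.eq_swap]
    by_cases h1 : r s < r p
    · exact hleft s t hst h1
    by_cases h2 : r t < r p
    · have := hleft t s hts h2
      tauto
    by_cases h3 : r q < r s
    · exact hright s t hst h3
    by_cases h4 : r q < r t
    · have := hright t s hts h4
      tauto
    rw [not_lt] at h1 h2 h3 h4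
    exact Or.inr (Or.inr ⟨hinner s hsS h1 h3, hinner t htS h2 h4⟩)
  refine ⟨A', B', r', ?_, ?_, ?_, ?_, ?_, ?_⟩
  · have hpw : (l₁ ++ p :: q :: l₂).Pairwise (fun a b => r' a < r' b ∧ A' a < A' b ∧ B' b < B' a) := by
      have hsub : (l₁ ++ p :: q :: l₂).Sublist L := by simp [hL]
      refine (h.contour.sublist hsub).imp_of_mem fun {a b} ha hb hab => ?_
      refine hlt a (hsub.subset ha) b (hsub.subset hb) ?_ hab
      simp only [List.mem_append, List.mem_cons] at ha
      rcases ha with ha | rfl | rfl | ha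
      · exact Or.inl (hl₁ a ha).1.le
      · exact Or.inl le_rfl
      · exact Or.inr hab.1.le
      · exact Or.inr ((hl₂ a ha).1.trans hab.1).le
    obtain ⟨k₁, k₂, k₃⟩ := List.pairwise_append.1 hpw
    obtain ⟨k₄, k₅⟩ := List.pairwise_cons.1 k₂
    obtain ⟨k₆, k₇⟩ := List.pairwise_cons.1 k₅
    refine List.pairwise_append.2 ⟨k₁, List.pairwise_cons.2 ⟨?_, List.pairwise_cons.2 ⟨?_, k₅⟩⟩, ?_⟩
    · intro b hb
      rcases List.mem_cons.1 hb with rfl | hb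
      · exact ⟨hvp.2.2, hvp.1, hvp.2.1⟩
      · exact k₄ b hb
    · intro b hb
      rcases List.mem_cons.1 hb with rfl | hb
      · exact ⟨hvq.2.2, hvq.1, hvq.2.1⟩
      · have := k₆ b hb
        exact ⟨by linarith, by omega, by omega⟩
    · intro a ha b hb
      have hap := k₃ a ha p (by simp)
      simp only [List.mem_cons] at hb
      rcases hb with rfl | rfl | rfl | hb
      · exact hap
      · exact ⟨by linarith, by omega, by omega⟩
      · exact k₃ a ha b (by simp)
      · exact k₃ a ha b (by simp [hb])
  · intro c hc'
    simp only [List.mem_append, List.mem_cons] at hc'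
    rcases hc' with hc' | rfl | rfl | rfl | hc'
    · exact Or.inr (hmem c (by simp [hL, hc']))
    · exact Or.inr hpS
    · exact Or.inl rfl
    · exact Or.inr hqS
    · exact Or.inr (hmem c (by simp [hL, hc']))
  · rintro w (rfl | hw)
    · exact ⟨w, by simp⟩
    · obtain ⟨c, hcL, hrc, hwc⟩ := h.proj w hw
      have hcS := hmem c hcL
      have e₁ := hmono c hcS w hw hrc.ge
      have e₂ := hmono w hw c hcS hrc.le
      by_cases hcm : c ∈ m
      · refine ⟨v, by simp, ?_⟩
        have i₁ := hc₂.1 c (by simp [hcm])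
        have i₂ := hc₃.2.2 c hcm q (by simp)
        rcases hcase w hw with h1 | h1 | h1
        · linarith
        · refine ⟨by rw [hr'v]; exact h1.2.2.2.2, Or.inr ?_⟩
          rcases hwc with rfl | hwc <;> omega
        · linarith
      · refine ⟨c, ?_, le_antisymm e₂.2.2 e₁.2.2, ?_⟩
        · simp only [hL, List.mem_append, List.mem_cons] at hcL ⊢
          tauto
        · rcases hwc with rfl | hwc
          · exact Or.inl rfl
          · right; omega
  · rintro s t (hst | ⟨i, hi, hst⟩)
    · obtain ⟨hsS, htS, hne, hst'⟩ := h.edge s t hst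
      refine ⟨Or.inr hsS, Or.inr htS, hne, fun hlt' => ?_⟩
      have hrst : r s < r t := by
        by_contra hcon
        have := (hmono t htS s hsS (not_lt.1 hcon)).2.2
        linarith
      have := hst' hrst
      have := hmono s hsS t htS hrst.le
      omega
    · obtain ⟨hiL, hpi, hiq⟩ := hm i hi
      have hiS := hmem i hiL
      have hiv := hne i hiS
      have hi₁ : r' i < r' v → A' i < A' v ∧ B' v < B' i := by
        intro hlt'
        rcases h.trichotomy hiL hp with t₁ | rfl | t₁
        · linarith
        · exact ⟨hvp.1, hvp.2.1⟩
        · rcases hcase i hiS with h1 | h1 | h1 <;> linarith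
      have hi₂ : r' v < r' i → A' v < A' i ∧ B' i < B' v := by
        intro hlt'
        rcases h.trichotomy hiL hq with t₁ | rfl | t₁
        · rcases hcase i hiS with h1 | h1 | h1 <;> linarith
        · exact ⟨hvq.1, hvq.2.1⟩
        · linarith
      rcases Sym2.eq_iff.1 hst with ⟨rfl, rfl⟩ | ⟨rfl, rfl⟩
      · exact ⟨Or.inl rfl, Or.inr hiS, hiv.symm, hi₂⟩
      · exact ⟨Or.inr hiS, Or.inl rfl, hiv, hi₁⟩
  · rintro s t w (hst | ⟨i, hi, hst⟩) hw hws hwt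
    · obtain ⟨hsS, htS, hne, -⟩ := h.edge s t hst
      rcases hw with rfl | hw
      · exact hsym s t hst
      · rcases h.empty s t w hst hw hws hwt with h1 | h1 | h1
        · have a₁ := hmono s hsS w hw h1.2.2.1
          have a₂ := hmono t htS w hw h1.2.2.2
          exact Or.inl ⟨by omega, by omega, a₁.2.2, a₂.2.2⟩
        · have a₁ := hmono w hw s hsS h1.2.2.1
          have a₂ := hmono w hw t htS h1.2.2.2
          exact Or.inr (Or.inl ⟨by omega, by omega, a₁.2.2, a₂.2.2⟩)
        · right; right
          rw [hsum s hsS, hsum t htS, hsum w hw]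
          omega
    · rcases Sym2.eq_iff.1 hst with ⟨rfl, rfl⟩ | ⟨rfl, rfl⟩
      · have := hnew t hi w (hw.resolve_left hws) hwt
        tauto
      · have := hnew s hi w (hw.resolve_left hwt) hws
        tauto
  · have hcard : (insert v S).ncard = S.ncard + 1 := Set.ncard_insert_of_notMem hv
    rw [hcard]
    push_cast
    rintro w (rfl | hw)
    · have := h.bound p hpS
      have := h.bound q hqS
      omega
    · have := h.bound w hw
      rcases hcase w hw with h1 | h1 | h1 <;> omega

end IsSchnyder

namespace Disc

variable {V : Type*}

/-- Every disc with the edge `xy` on its boundary can be glued below that edge to a Schnyder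
drawing. -/
def Gluable (V : Type*) (n : ℕ) : Prop :=
  ∀ (x y : V) (l l₁ l₂ : List V) (D S : Set V) (F E : Set (Sym2 V)),
    Disc n (x :: (l ++ [y])) D F →
    (∃ A B r, IsSchnyder (l₁ ++ x :: y :: l₂) S E A B r) → S ∩ D = {x, y} →
    ∃ A B r, IsSchnyder (l₁ ++ x :: (l ++ y :: l₂)) (S ∪ D) (E ∪ F) A B r

theorem glue_fan [Finite V] (n : ℕ) (IH : ∀ k < n, Gluable V k) :
    ∀ (N : ℕ), N ≤ n → ∀ (x y k z : V) (ch cs rest l₁ l₂ : List V) (D S : Set V)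
    (F E : Set (Sym2 V)),
    Disc N (ch ++ k :: z :: (rest ++ [y])) D F → ch ++ [k] = x :: cs →
    (∀ c ∈ ch, s(z, c) ∉ F) →
    (∃ A B r, IsSchnyder (l₁ ++ x :: y :: l₂) S E A B r) → S ∩ D = {x, y} →
    ∃ A B r, IsSchnyder (l₁ ++ x :: z :: (rest ++ y :: l₂)) (S ∪ D)
      (E ∪ F ∪ {e | ∃ i ∈ x :: cs, e = s(z, i)}) A B r := by
  intro N
  induction N with
  | zero => intro _ x y k z ch cs rest l₁ l₂ D S F E h; exact absurd h.pos (lt_irrefl _)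
  | succ N ih =>
    intro hNn x y k z ch cs rest l₁ l₂ D S F E h hch hnew hS hSD
    have hnodup := h.nodup
    have r₀ := rotate (a := ch ++ [k]) (b := z :: (rest ++ [y])) (by simpa using h)
    have r₁ : Disc (N + 1) (z :: ((rest ++ [y] ++ ch) ++ [k])) D F := by simpa using r₀
    have hxD : x ∈ D := h.mem_of_mem x (by
      have : x ∈ ch ++ [k] := by simp [hch]
      simp only [List.mem_append, List.mem_cons, List.not_mem_nil, or_false] at this ⊢
      tauto)
    have hzx : z ≠ x := by
      have : x ∈ ch ++ [k] := by simp [hch]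
      rintro rfl
      have h2 : (ch ++ [k] ++ (z :: (rest ++ [y]))).Nodup := by simpa using hnodup
      exact (List.nodup_append.1 h2).2.2 z this z (by simp) rfl
    have hxy : x ≠ y := by
      have : x ∈ ch ++ [k] := by simp [hch]
      rintro rfl
      have h2 : (ch ++ [k] ++ (z :: (rest ++ [x]))).Nodup := by simpa using hnodup
      exact (List.nodup_append.1 h2).2.2 x this x (by simp) rfl
    have hzy : z ≠ y := by
      rintro rfl
      have h2 : (ch ++ [k] ++ (z :: (rest ++ [z]))).Nodup := by simpa using hnodup
      have h3 := (List.nodup_append.1 h2).2.1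
      simp at h3
    have hzD : z ∈ D := h.mem_of_mem z (by simp)
    have hyD : y ∈ D := h.mem_of_mem y (by simp)
    have hzS : z ∉ S := fun hz => by
      have : z ∈ S ∩ D := ⟨hz, hzD⟩
      rw [hSD] at this
      rcases this with h | h
      · exact hzx h
      · exact hzy h
    obtain ⟨-, -, hl, -, -⟩ |
      ⟨m₁, m₂, d, t₁, t₂, D₁, D₂, F₁, F₂, g₁, g₂, hA, hN, hl, rfl, rfl⟩ |
      ⟨m', c, F', g, hF', hN, rfl⟩ := r₁.inv_cons_append
    · simp at hl
    · have hd : d ∈ D₁ ∧ d ∈ D₂ := by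
        have : d ∈ D₁ ∩ D₂ := by rw [hA]; rfl
        exact this
      have hp₁ := g₁.pos
      have hp₂ := g₂.pos
      have main : ∀ rest₂ : List V, rest ++ [y] = t₁ ++ d :: rest₂ → t₂ = rest₂ ++ ch →
          ∃ A B r, IsSchnyder (l₁ ++ x :: z :: (rest ++ y :: l₂)) (S ∪ (D₁ ∪ D₂))
            (E ∪ insert s(k, z) (F₁ ∪ F₂) ∪ {e | ∃ i ∈ x :: cs, e = s(z, i)}) A B r := by
        rintro rest₂ hr rfl
        have q₁ := rotate (a := d :: rest₂) (b := ch ++ [k]) (by simpa using g₂)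
        rw [hch] at q₁
        have hx₂ : x ∈ D₂ := q₁.mem_of_mem x (by simp)
        have hz₁ : z ∈ D₁ := g₁.mem_of_mem z (by simp)
        obtain ⟨m, hm⟩ : ∃ m, cs ++ (d :: rest₂) = m ++ [y] := by
          obtain rfl | ⟨rest₂, e, rfl⟩ := List.eq_nil_or_concat rest₂
          · obtain ⟨-, h2⟩ := List.append_inj' hr rfl
            simp at h2
            exact ⟨cs, by simp [h2]⟩
          · obtain ⟨-, h2⟩ := List.append_inj' (s₁ := rest) (t₁ := [y])
              (s₂ := t₁ ++ d :: rest₂) (t₂ := [e]) (by simpa using hr) rfl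
            simp at h2
            exact ⟨cs ++ d :: rest₂, by simp [h2]⟩
        have hy₂ : y ∈ D₂ := q₁.mem_of_mem y (by
          have : y ∈ cs ++ (d :: rest₂) := by simp [hm]
          simp only [List.cons_append, List.mem_cons]
          exact Or.inr this)
        have hq₁n := q₁.nodup
        have hxd : x ≠ d := by
          rintro rfl
          simp at hq₁n
        have hzd : z ≠ d := by
          have := g₁.nodup
          rintro rfl
          simp at this
        have hS₂ : S ∩ D₂ = {x, y} := by
          apply Set.Subset.antisymm
          · rw [← hSD]
            exact Set.inter_subset_inter_right _ Set.subset_union_right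
          · rintro u hu
            have : u ∈ S ∩ (D₁ ∪ D₂) := by rw [hSD]; exact hu
            refine ⟨this.1, ?_⟩
            rcases hu with rfl | rfl
            · exact hx₂
            · exact hy₂
        obtain ⟨A, B, r, hs₁⟩ := IH m₂ (by omega) x y m l₁ l₂ D₂ S F₂ E
          (by rw [← hm]; simpa using q₁) hS hS₂
        have e₁ : m ++ y :: l₂ = cs ++ d :: (rest₂ ++ l₂) := by
          have : m ++ y :: l₂ = (m ++ [y]) ++ l₂ := by simp
          rw [this, ← hm]; simp
        rw [e₁] at hs₁
        have hz₂ : z ∉ S ∪ D₂ := by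
          rintro (h1 | h1)
          · exact hzS h1
          · exact hzd (mem_singleton_of_inter hA hz₁ h1)
        have hs₂ := hs₁.insert_vertex hz₂
        have hint : insert z (S ∪ D₂) ∩ D₁ = {z, d} := by
          apply Set.Subset.antisymm
          · rintro u ⟨rfl | hu | hu, hu₁⟩
            · exact Or.inl rfl
            · have hu' : u ∈ S ∩ (D₁ ∪ D₂) := ⟨hu, Or.inl hu₁⟩
              rw [hSD] at hu'
              rcases hu' with rfl | rfl
              · exact Or.inr (mem_singleton_of_inter hA hu₁ hx₂)
              · exact Or.inr (mem_singleton_of_inter hA hu₁ hy₂)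
            · exact Or.inr (mem_singleton_of_inter hA hu₁ hu)
          · rintro u (rfl | rfl)
            · exact ⟨Or.inl rfl, hz₁⟩
            · exact ⟨Or.inr (Or.inr hd.2), hd.1⟩
        have e₄ : ∀ l : List V, (l₁ ++ [x]) ++ z :: l = l₁ ++ x :: z :: l := by simp
        rw [← e₄] at hs₂
        obtain ⟨A', B', r', hs₃⟩ := IH m₁ (by omega) z d t₁ (l₁ ++ [x]) (rest₂ ++ l₂) D₁ _ F₁ _
          g₁ hs₂ hint
        rw [e₄] at hs₃
        have e₂ : rest ++ y :: l₂ = t₁ ++ d :: (rest₂ ++ l₂) := by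
          have : rest ++ y :: l₂ = (rest ++ [y]) ++ l₂ := by simp
          rw [this, hr]; simp
        have e₃ : S ∪ (D₁ ∪ D₂) = insert z (S ∪ D₂) ∪ D₁ := by
          ext u
          have : u = z → u ∈ D₁ := by rintro rfl; exact hz₁
          simp only [Set.mem_union, Set.mem_insert_iff]
          tauto
        rw [e₂, e₃]
        refine ⟨A', B', r', hs₃.mono ?_⟩
        have hk : k ∈ x :: cs := by simp [← hch]
        rintro e ((he | rfl | he | he) | ⟨i, hi, he⟩)
        · exact Or.inl (Or.inl (Or.inl he))
        · exact Or.inl (Or.inr ⟨k, by rw [← List.cons_append]; exact List.mem_append_left _ hk,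
            Sym2.eq_swap⟩)
        · exact Or.inr he
        · exact Or.inl (Or.inl (Or.inr he))
        · exact Or.inl (Or.inr ⟨i, by rw [← List.cons_append]; exact List.mem_append_left _ hi, he⟩)
      rcases List.append_eq_append_iff.1 hl with ⟨a', h1, h2⟩ | ⟨c', h1, h2⟩
      · have hdc : d ∈ ch := by simp [h2]
        exact absurd (Or.inr (Or.inl (by rw [Sym2.eq_swap]; exact closing g₁))) (hnew d hdc)
      · cases c' with
        | nil =>
          have hdc : d ∈ ch := by
            have h2' : d :: t₂ = ch := by simpa using h2
            simp [← h2']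
          exact absurd (Or.inr (Or.inl (by rw [Sym2.eq_swap]; exact closing g₁))) (hnew d hdc)
        | cons d' c' =>
          obtain ⟨rfl, h3⟩ := List.cons.inj h2
          exact main c' h1 h3
    · have hN' : m' = N := by omega
      subst hN'
      have q₁ := rotate (a := c :: z :: (rest ++ [y])) (b := ch ++ [k]) (by simpa using g)
      have hch' : (ch ++ [k]) ++ [c] = x :: (cs ++ [c]) := by rw [hch]; simp
      obtain ⟨A, B, r, hs⟩ := ih (by omega) x y c z (ch ++ [k]) (cs ++ [c]) rest l₁ l₂ D S F' E
        (by simpa using q₁) hch' (by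
          intro c' hc'
          rcases List.mem_append.1 hc' with hc' | hc'
          · exact fun hh => hnew c' hc' (Or.inr hh)
          · simp at hc'; subst hc'; rwa [Sym2.eq_swap]) hS hSD
      refine ⟨A, B, r, hs.mono ?_⟩
      have hk : k ∈ x :: cs := by simp [← hch]
      rintro e ((he | rfl | he) | ⟨i, hi, he⟩)
      · exact Or.inl (Or.inl he)
      · exact Or.inr ⟨k, by rw [← List.cons_append]; exact List.mem_append_left _ hk, Sym2.eq_swap⟩
      · exact Or.inl (Or.inr he)
      · exact Or.inr ⟨i, by rw [← List.cons_append]; exact List.mem_append_left _ hi, he⟩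

theorem gluable [Finite V] (n : ℕ) : Gluable V n := by
  induction n using Nat.strong_induction_on with
  | _ n IH =>
    intro x y l l₁ l₂ D S F E h hS hSD
    cases l with
    | nil =>
      obtain ⟨-, rfl, rfl⟩ := eq_of_pair h
      obtain ⟨A, B, r, hs⟩ := hS
      have hsub : S ∪ {x, y} = S := by
        rw [← hSD]; simp
      rw [hsub]
      exact ⟨A, B, r, hs.add_edge.mono (by simp)⟩
    | cons z rest =>
      obtain ⟨A, B, r, hs⟩ := glue_fan n IH n le_rfl x y x z [] [] rest l₁ l₂ D S F E
        (by simpa using h) rfl (by simp) hS hSD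
      exact ⟨A, B, r, hs.mono Set.subset_union_left⟩

theorem exists_isSchnyder [Finite V] {n : ℕ} {L : List V} {S : Set V} {E : Set (Sym2 V)}
    (h : Disc n L S E) : ∃ L' A B r, IsSchnyder L' S E A B r := by
  obtain ⟨x, y, l, rfl⟩ : ∃ x y l, L = x :: (l ++ [y]) := by
    cases h with
    | edge => exact ⟨_, _, [], rfl⟩
    | @join m n x z d l₁ l₂ => exact ⟨x, z, l₁ ++ d :: l₂, by simp⟩
    | cover => exact ⟨_, _, _, rfl⟩
  have hxy : x ≠ y := by
    have := h.nodup
    rintro rfl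
    simp at this
  obtain ⟨A, B, r, hs⟩ := gluable n x y l [] [] S {x, y} E ∅ h (IsSchnyder.pair hxy) (by
    apply Set.inter_eq_left.2
    rintro u (rfl | rfl)
    · exact h.mem_of_mem _ (by simp)
    · exact h.mem_of_mem _ (by simp))
  have e : {x, y} ∪ S = S := by
    apply Set.union_eq_right.2
    rintro u (rfl | rfl)
    · exact h.mem_of_mem _ (by simp)
    · exact h.mem_of_mem _ (by simp)
  rw [e] at hs
  exact ⟨_, A, B, r, hs.mono (by simp)⟩

end Disc

section Sweep

variable {V : Type*} {X Y : V → ℝ}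

/-- The height above the abscissa `x` of the line through the images of `s` and `t`. -/
noncomputable def lineHeight (X Y : V → ℝ) (s t : V) (x : ℝ) : ℝ :=
  Y s + (Y t - Y s) / (X t - X s) * (x - X s)

theorem lineHeight_left (s t : V) : lineHeight X Y s t (X s) = Y s := by
  simp [lineHeight]

theorem lineHeight_right {s t : V} (h : X s < X t) : lineHeight X Y s t (X t) = Y t := by
  have : X t - X s ≠ 0 := by linarith
  unfold lineHeight
  field_simp
  ring

/-- A set of rightward directed edges without crossings. -/
structure IsPlaneEdgeSet (X Y : V → ℝ) (D : Set (V × V)) : Prop where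
  lt : ∀ e ∈ D, X e.1 < X e.2
  meet : ∀ e ∈ D, ∀ e' ∈ D, e ≠ e' → ∀ x, X e.1 ≤ x → x ≤ X e.2 → X e'.1 ≤ x → x ≤ X e'.2 →
    lineHeight X Y e.1 e.2 x = lineHeight X Y e'.1 e'.2 x →
    ∃ v, (v = e.1 ∨ v = e.2) ∧ (v = e'.1 ∨ v = e'.2) ∧ X v = x

theorem IsPlaneEdgeSet.mono {D D' : Set (V × V)} (h : IsPlaneEdgeSet X Y D) (hD : D' ⊆ D) :
    IsPlaneEdgeSet X Y D' :=
  ⟨fun e he => h.lt e (hD he), fun e he e' he' => h.meet e (hD he) e' (hD he')⟩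

/-- Two distinct edges whose vertical order changes between two abscissas meet in between. -/
theorem IsPlaneEdgeSet.exists_common {D : Set (V × V)} (h : IsPlaneEdgeSet X Y D) {e e' : V × V}
    (he : e ∈ D) (he' : e' ∈ D) (hne : e ≠ e') {x₁ x₂ : ℝ} (hx : x₁ ≤ x₂) (h₁ : X e.1 ≤ x₁)
    (h₂ : x₂ ≤ X e.2) (h₁' : X e'.1 ≤ x₁) (h₂' : x₂ ≤ X e'.2)
    (hle : lineHeight X Y e'.1 e'.2 x₁ ≤ lineHeight X Y e.1 e.2 x₁)
    (hge : lineHeight X Y e.1 e.2 x₂ ≤ lineHeight X Y e'.1 e'.2 x₂) :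
    ∃ v, (v = e.1 ∨ v = e.2) ∧ (v = e'.1 ∨ v = e'.2) ∧ x₁ ≤ X v ∧ X v ≤ x₂ := by
  have hc : ContinuousOn
      (fun x => lineHeight X Y e'.1 e'.2 x - lineHeight X Y e.1 e.2 x) (Set.Icc x₁ x₂) := by
    unfold lineHeight; fun_prop
  obtain ⟨x, ⟨hx₁, hx₂⟩, h0⟩ := intermediate_value_Icc hx hc
    (show (0 : ℝ) ∈ Set.Icc _ _ from ⟨by simpa using hle, by simpa using hge⟩)
  obtain ⟨v, hv, hv', rfl⟩ := h.meet e he e' he' hne x (by linarith) (by linarith) (by linarith)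
    (by linarith) (by simp only at h0; linarith)
  exact ⟨v, hv, hv', hx₁, hx₂⟩

/-- No edge of `D` passes over or through the image of `w`. -/
def IsUncovered (X Y : V → ℝ) (D : Set (V × V)) (w : V) : Prop :=
  ∀ e ∈ D, X e.1 < X w → X w < X e.2 → lineHeight X Y e.1 e.2 (X w) < Y w

/-- The edge `e` leaves an exposed vertex to the right, and is the steepest one to do so. -/
structure IsSteepest (X Y : V → ℝ) (D : Set (V × V)) (e : V × V) : Prop where
  mem : e ∈ D
  exposed : IsUncovered X Y D e.1
  rightmost : ∀ e' ∈ D, IsUncovered X Y D e'.1 → X e'.1 ≤ X e.1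
  steep : ∀ e' ∈ D, e'.1 = e.1 → ∀ x, X e.1 ≤ x →
    lineHeight X Y e'.1 e'.2 x ≤ lineHeight X Y e.1 e.2 x

theorem exists_isSteepest {D : Finset (V × V)}
    (hD : D.Nonempty) : ∃ e, IsSteepest X Y (D : Set (V × V)) e := by
  classical
  obtain ⟨e₀, he₀, hmin⟩ := D.exists_min_image (fun e => X e.1) hD
  have h₀ : IsUncovered X Y (D : Set (V × V)) e₀.1 := fun e he h1 _ =>
    absurd (hmin e he) (by simpa using h1)
  obtain ⟨e₁, he₁, hmax⟩ := (D.filter fun e => IsUncovered X Y (D : Set (V × V)) e.1).exists_max_image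
    (fun e => X e.1) ⟨e₀, by simpa using ⟨he₀, h₀⟩⟩
  obtain ⟨h₁, h₁'⟩ := Finset.mem_filter.1 he₁
  obtain ⟨e, he, hst⟩ := (D.filter fun e => e.1 = e₁.1).exists_max_image
    (fun e => (Y e.2 - Y e.1) / (X e.2 - X e.1)) ⟨e₁, by simpa using h₁⟩
  obtain ⟨h₂, h₂'⟩ := Finset.mem_filter.1 he
  refine ⟨e, h₂, by rwa [h₂'], ?_, ?_⟩
  · intro e' he' hh
    rw [h₂']
    exact hmax e' (Finset.mem_filter.2 ⟨he', hh⟩)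
  · intro e' he' heq x hx
    have h3 := hst e' (Finset.mem_filter.2 ⟨he', by rw [heq, h₂']⟩)
    unfold lineHeight
    simp only [heq] at h3 ⊢
    have := mul_le_mul_of_nonneg_right h3 (sub_nonneg.2 hx)
    linarith

/-- No edge passes weakly above a vertex that is strictly above the steepest edge and leftmost
among such. -/
theorem IsSteepest.not_under {D : Set (V × V)} {e e' : V × V} {u : V} (hP : IsPlaneEdgeSet X Y D)
    (hX : Function.Injective X) (h : IsSteepest X Y D e) (hu₁ : X e.1 < X u) (hu₂ : X u ≤ X e.2)
    (hu : lineHeight X Y e.1 e.2 (X u) ≤ Y u)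
    (hleft : ∀ e' ∈ D, X e.1 < X e'.1 → X e'.1 < X u → Y e'.1 ≤ lineHeight X Y e.1 e.2 (X e'.1))
    (hnot : e.2 = u ∨ lineHeight X Y e.1 e.2 (X u) < Y u)
    (he' : e' ∈ D) (h₁ : X e'.1 < X u) (h₂ : X u ≤ X e'.2) (h₃ : u = e.2 → X u < X e'.2)
    (hover : Y u ≤ lineHeight X Y e'.1 e'.2 (X u)) : False := by
  have hne : e ≠ e' := by
    rintro rfl
    rcases hnot with h4 | h4
    · subst h4
      exact lt_irrefl _ (h₃ rfl)
    · linarith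
  have hu₂' : u = e.2 ∨ X u < X e.2 := by
    rcases hu₂.eq_or_lt with h5 | h5
    · exact Or.inl (hX h5)
    · exact Or.inr h5
  rcases lt_trichotomy (X e'.1) (X e.1) with hlt | heq | hgt
  · have h4 := h.exposed e' he' hlt (by linarith)
    obtain ⟨v, hv, hv', h5, h6⟩ := hP.exists_common h.mem he' hne hu₁.le le_rfl hu₂ hlt.le h₂
      (by rw [lineHeight_left]; exact h4.le) (by linarith)
    rcases hv' with rfl | rfl
    · linarith
    · have := hP.lt _ he'
      have h7 : X u = X e'.2 := le_antisymm h₂ h6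
      rcases hu₂' with h8 | h8
      · linarith [h₃ h8]
      · rcases hv with h9 | h9
        · rw [h9] at h7; linarith
        · rw [h9] at h7; linarith
  · have heq' := hX heq
    have h4 := h.steep e' he' heq' (X u) hu₁.le
    have h5 : lineHeight X Y e.1 e.2 (X u) = lineHeight X Y e'.1 e'.2 (X u) := by linarith
    obtain ⟨v, hv, hv', h6⟩ := hP.meet e h.mem e' he' hne (X u) hu₁.le hu₂ (by linarith) h₂ h5
    rcases hnot with h8 | h8
    · have h9 := h₃ h8.symm
      rcases hv' with rfl | rfl <;> linarith
    · linarith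
  · have h4 := hleft e' he' hgt h₁
    obtain ⟨v, hv, hv', h5, h6⟩ := hP.exists_common h.mem he' hne h₁.le hgt.le hu₂ le_rfl h₂
      (by rw [lineHeight_left]; exact h4) (by linarith)
    rcases hv with rfl | rfl
    · linarith
    · have h7 : X u = X e.2 := le_antisymm hu₂ h6
      have h8 := h₃ (hX h7)
      rcases hv' with h9 | h9
      · rw [h9] at h7; linarith
      · rw [h9] at h7; linarith

theorem exists_append_cons_cons_of_pairwise {u : V} : ∀ {L : List V},
    L.Pairwise (fun v w => X v < X w) → (∀ w ∈ L, X w ≠ X u) → (∃ a ∈ L, X a < X u) →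
    (∃ b ∈ L, X u < X b) → ∃ l₁ p q l₂, L = l₁ ++ p :: q :: l₂ ∧ X p < X u ∧ X u < X q
  | [], _, _, h, _ => by simp at h
  | [x], _, _, ⟨a, ha, h₁⟩, ⟨b, hb, h₂⟩ => by
    simp only [List.mem_singleton] at ha hb
    subst ha hb
    linarith
  | x :: y :: L, hL, hne, ⟨a, ha, h₁⟩, ⟨b, hb, h₂⟩ => by
    obtain ⟨hx, hL'⟩ := List.pairwise_cons.1 hL
    have hxu : X x < X u := by
      rcases List.mem_cons.1 ha with rfl | ha
      · exact h₁
      · exact (hx a ha).trans h₁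
    rcases (hne y (by simp)).lt_or_gt with hy | hy
    · obtain ⟨l₁, p, q, l₂, h, hp, hq⟩ := exists_append_cons_cons_of_pairwise hL'
        (fun w hw => hne w (List.mem_cons_of_mem _ hw)) ⟨y, by simp, hy⟩ ⟨b, by
          rcases List.mem_cons.1 hb with rfl | hb
          · linarith
          · exact hb, h₂⟩
      exact ⟨x :: l₁, p, q, l₂, by rw [h]; rfl, hp, hq⟩
    · exact ⟨[], x, y, L, rfl, hxu, hy⟩

/-- The edges of a crossing-free drawing are contained in the edge set of a disc whose contour
visits all uncovered vertices from left to right. -/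
theorem IsPlaneEdgeSet.exists_disc (hX : Function.Injective X) {a b : V} (hab : a ≠ b) :
    ∀ (N : ℕ) (S : Finset V) (D : Finset (V × V)), S.card + D.card = N → a ∈ S → b ∈ S →
    (∀ v ∈ S, X a ≤ X v ∧ X v ≤ X b) → (∀ e ∈ D, e.1 ∈ S ∧ e.2 ∈ S) →
    IsPlaneEdgeSet X Y (D : Set (V × V)) →
    ∃ n L E, Disc n L (S : Set V) E ∧ L.Pairwise (fun u v => X u < X v) ∧
      (∀ e ∈ D, s(e.1, e.2) ∈ E) ∧ ∀ w ∈ S, IsUncovered X Y (D : Set (V × V)) w → w ∈ L := by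
  classical
  intro N
  induction N using Nat.strong_induction_on with
  | _ N IH =>
    intro S D hN ha hb hS hDS hP
    have remove : ∀ u ∈ S, u ≠ a → u ≠ b → (∀ e ∈ D, e.1 ≠ u ∧ e.2 ≠ u) →
        ∃ n L E, Disc n L (S : Set V) E ∧ L.Pairwise (fun u v => X u < X v) ∧
          (∀ e ∈ D, s(e.1, e.2) ∈ E) ∧
          ∀ w ∈ S, IsUncovered X Y (D : Set (V × V)) w → w ∈ L := by
      intro u hu hua hub hD
      have hcard := Finset.card_erase_lt_of_mem hu
      have haS : a ∈ S.erase u := Finset.mem_erase.2 ⟨hua.symm, ha⟩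
      have hbS : b ∈ S.erase u := Finset.mem_erase.2 ⟨hub.symm, hb⟩
      obtain ⟨n, L, E, hd, hL, hE, hunc⟩ := IH ((S.erase u).card + D.card) (by omega) (S.erase u) D
        rfl haS hbS (fun v hv => hS v (Finset.mem_of_mem_erase hv))
        (fun e he => ⟨Finset.mem_erase.2 ⟨(hD e he).1, (hDS e he).1⟩,
          Finset.mem_erase.2 ⟨(hD e he).2, (hDS e he).2⟩⟩) hP
      have haL : a ∈ L := hunc a haS fun e he h1 _ =>
        absurd (hS _ (hDS e he).1).1 (not_le.2 h1)
      have hbL : b ∈ L := hunc b hbS fun e he _ h1 =>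
        absurd (hS _ (hDS e he).2).2 (not_le.2 h1)
      have huL : u ∉ L := fun h => by simpa using hd.mem_of_mem u h
      obtain ⟨l₁, p, q, l₂, rfl, hp, hq⟩ := exists_append_cons_cons_of_pairwise (u := u) hL
        (fun w hw h => huL (hX h ▸ hw)) ⟨a, haL, (hS u hu).1.lt_of_ne fun h => hua (hX h).symm⟩
        ⟨b, hbL, (hS u hu).2.lt_of_ne fun h => hub (hX h)⟩
      refine ⟨_, _, _, (hd.insert_vertex (v := u) (by simp)).congr rfl rfl ?_ rfl, ?_, ?_, ?_⟩
      · rw [Finset.coe_erase, Set.insert_sdiff_singleton, Set.insert_eq_of_mem (by simpa using hu)]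
      · have h1 := List.pairwise_append.1 hL
        have h2 := List.pairwise_cons.1 h1.2.1
        have h3 := List.pairwise_cons.1 h2.2
        have h4 := h1.2.2
        refine List.pairwise_append.2 ⟨h1.1, List.pairwise_cons.2 ⟨?_, List.pairwise_cons.2 ⟨?_,
          h2.2⟩⟩, ?_⟩
        · intro w hw
          rcases List.mem_cons.1 hw with rfl | hw
          · exact hp
          · exact h2.1 w hw
        · intro w hw
          rcases List.mem_cons.1 hw with rfl | hw
          · exact hq
          · exact hq.trans (h3.1 w hw)
        · intro v hv w hw
          rcases List.mem_cons.1 hw with rfl | hw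
          · exact h4 v hv _ (by simp)
          · rcases List.mem_cons.1 hw with rfl | hw
            · exact (h4 v hv p (by simp)).trans hp
            · exact h4 v hv w (List.mem_cons_of_mem _ hw)
      · exact fun e he => Or.inr (Or.inr (hE e he))
      · intro w hw hw'
        rcases eq_or_ne w u with rfl | hwu
        · simp
        · have := hunc w (Finset.mem_erase.2 ⟨hwu, hw⟩) hw'
          simp only [List.mem_append, List.mem_cons] at this ⊢
          tauto
    rcases D.eq_empty_or_nonempty with rfl | hne
    · by_cases hu : ∃ u ∈ S, u ≠ a ∧ u ≠ b
      · obtain ⟨u, hu, hua, hub⟩ := hu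
        exact remove u hu hua hub (by simp)
      · push Not at hu
        have hSab : S = {a, b} := by
          ext u
          simp only [Finset.mem_insert, Finset.mem_singleton]
          constructor
          · intro h
            by_cases h' : u = a
            · exact Or.inl h'
            · exact Or.inr (hu u h h')
          · rintro (rfl | rfl) <;> assumption
        refine ⟨1, [a, b], {s(a, b)}, (Disc.edge hab).congr rfl rfl (by simp [hSab]) rfl, ?_, by simp,
          ?_⟩
        · simpa using (hS a ha).2.lt_of_ne fun h => hab (hX h)
        · intro w hw _
          simpa [hSab] using hw
    · obtain ⟨e, hst⟩ := exists_isSteepest (X := X) (Y := Y) hne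
      have hlt := hP.lt e hst.mem
      have heD : e ∈ D := hst.mem
      by_cases hab' : ∃ u ∈ S, X e.1 < X u ∧ X u < X e.2 ∧ lineHeight X Y e.1 e.2 (X u) < Y u
      · obtain ⟨u, hu, hmin⟩ := (S.filter fun u => X e.1 < X u ∧ X u < X e.2 ∧
          lineHeight X Y e.1 e.2 (X u) < Y u).exists_min_image X (by
            obtain ⟨u, hu, h⟩ := hab'
            exact ⟨u, Finset.mem_filter.2 ⟨hu, h⟩⟩)
        obtain ⟨huS, hu₁, hu₂, hu₃⟩ := Finset.mem_filter.1 hu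
        have key : ∀ e' ∈ D, X e'.1 < X u → X u ≤ X e'.2 →
            Y u ≤ lineHeight X Y e'.1 e'.2 (X u) → False := by
          intro e' he' h1 h2 h3
          refine hst.not_under hP hX hu₁ hu₂.le hu₃.le ?_ (Or.inr hu₃) he' h1 h2
            (by rintro rfl; exact absurd hu₂ (lt_irrefl _)) h3
          intro e'' he'' h4 h5
          by_contra! h6
          have := hmin e''.1 (Finset.mem_filter.2 ⟨(hDS e'' he'').1, h4, h5.trans hu₂, h6⟩)
          linarith
        refine remove u huS ?_ ?_ ?_
        · rintro rfl
          linarith [(hS _ (hDS e heD).1).1]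
        · rintro rfl
          linarith [(hS _ (hDS e heD).2).2]
        · intro e' he'
          constructor
          · rintro rfl
            have := hst.rightmost e' he' fun e'' he'' h1 h2 => by
              by_contra! h3
              exact key e'' he'' h1 h2.le h3
            linarith
          · rintro rfl
            exact key e' he' (hP.lt e' he') le_rfl (lineHeight_right (hP.lt e' he')).ge
      · push Not at hab'
        have ht : IsUncovered X Y (D : Set (V × V)) e.2 := by
          intro e' he' h1 h2
          by_contra! h3
          refine hst.not_under hP hX hlt le_rfl (lineHeight_right hlt).le ?_ (Or.inl rfl) he' h1 h2.le
            (fun _ => h2) h3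
          exact fun e'' he'' h4 h5 => hab' _ (hDS e'' he'').1 h4 h5
        have hcard := Finset.card_erase_lt_of_mem heD
        have hmono : ((D.erase e : Finset (V × V)) : Set (V × V)) ⊆ D := by simp
        have hunc' : ∀ w, IsUncovered X Y (D : Set (V × V)) w →
            IsUncovered X Y ((D.erase e : Finset (V × V)) : Set (V × V)) w :=
          fun w h e he => h e (hmono he)
        obtain ⟨n, L, E, hd, hL, hE, hunc⟩ := IH (S.card + (D.erase e).card) (by omega) S (D.erase e)
          rfl ha hb hS (fun e' he' => hDS e' (Finset.mem_of_mem_erase he')) (hP.mono hmono)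
        by_cases hEe : s(e.1, e.2) ∈ E
        · refine ⟨n, L, E, hd, hL, ?_, fun w hw h => hunc w hw (hunc' w h)⟩
          intro e' he'
          rcases eq_or_ne e' e with rfl | h
          · exact hEe
          · exact hE e' (Finset.mem_erase.2 ⟨h, he'⟩)
        have hsL := hunc _ (hDS e heD).1 (hunc' _ hst.exposed)
        have htL := hunc _ (hDS e heD).2 (hunc' _ ht)
        obtain ⟨l₁, l, rfl⟩ := List.append_of_mem hsL
        have h1 := List.pairwise_append.1 hL
        have h2 := List.pairwise_cons.1 h1.2.1
        have htl : e.2 ∈ l := by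
          rcases List.mem_append.1 htL with h | h
          · linarith [h1.2.2 _ h e.1 (by simp)]
          · rcases List.mem_cons.1 h with h | h
            · rw [h] at hlt; exact absurd hlt (lt_irrefl _)
            · exact h
        obtain ⟨m, l₂, rfl⟩ := List.append_of_mem htl
        have hm : m ≠ [] := by
          rintro rfl
          exact hEe hd.edge_of_append
        obtain ⟨n', E', hEE, hst', hd'⟩ := Disc.exists_cover_segment _ _ _ _ _ _ _ _ _ rfl hd hm hEe
        refine ⟨n', _, E', hd', hL.sublist ?_, ?_, ?_⟩
        · exact (List.Sublist.cons_cons _ (List.sublist_append_right _ _)).append_left _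
        · intro e' he'
          rcases eq_or_ne e' e with rfl | h
          · exact hst'
          · exact hEE (hE e' (Finset.mem_erase.2 ⟨h, he'⟩))
        · intro w hw hw'
          have h3 := hunc w hw (hunc' w hw')
          have h4 : w ∉ m := by
            intro hwm
            have h5 := h2.1 w (List.mem_append_left _ hwm)
            have h6 := (List.pairwise_append.1 h2.2).2.2 w hwm e.2 (by simp)
            have h7 := hw' e heD h5 h6
            have h8 := hab' w hw h5 h6
            linarith
          simp only [List.mem_append, List.mem_cons] at h3 ⊢
          tauto

end Sweep

/-- Some shear of a finite point set has distinct first coordinates. -/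
theorem exists_shear_injective {V : Type*} [Finite V] {f : V → ℝ × ℝ}
    (hf : Function.Injective f) : ∃ ε : ℝ, Function.Injective fun v => (f v).1 + ε * (f v).2 := by
  have hfin : (Set.range fun p : V × V => -((f p.1).1 - (f p.2).1) / ((f p.1).2 - (f p.2).2)).Finite :=
    Set.finite_range _
  obtain ⟨ε, hε⟩ := hfin.infinite_compl.nonempty
  refine ⟨ε, fun u v huv => hf ?_⟩
  simp only at huv
  by_cases h : (f u).2 = (f v).2
  · exact Prod.ext (by rw [h] at huv; linarith) h
  · refine absurd ⟨(u, v), ?_⟩ hε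
    have : (f u).2 - (f v).2 ≠ 0 := sub_ne_zero.2 h
    simp only
    rw [div_eq_iff this]
    linarith

theorem IsCrossingFreeDrawing.exists_disc {V : Type*} [Finite V] [Nontrivial V]
    {G : SimpleGraph V} {f : V → ℝ × ℝ} (hf : IsCrossingFreeDrawing G f) :
    ∃ n L E, Disc n L (Set.univ : Set V) E ∧ ∀ u v, G.Adj u v → s(u, v) ∈ E := by
  classical
  cases nonempty_fintype V
  obtain ⟨ε, hX⟩ := exists_shear_injective hf.1
  set X : V → ℝ := fun v => (f v).1 + ε * (f v).2 with hXdef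
  set Y : V → ℝ := fun v => (f v).2 with hYdef
  obtain ⟨a, -, ha⟩ := Finset.univ.exists_min_image X (Finset.univ_nonempty (α := V))
  obtain ⟨b, -, hb⟩ := Finset.univ.exists_max_image X (Finset.univ_nonempty (α := V))
  have hab : a ≠ b := by
    rintro rfl
    obtain ⟨u, v, huv⟩ := exists_pair_ne V
    exact huv (hX (by linarith [ha u (by simp), ha v (by simp), hb u (by simp), hb v (by simp)]))
  have hseg : ∀ (s t : V) (x : ℝ), X s < X t → X s ≤ x → x ≤ X t →
      (x - ε * lineHeight X Y s t x, lineHeight X Y s t x) ∈ segment ℝ (f s) (f t) := by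
    intro s t x hst h1 h2
    have h3 : 0 < X t - X s := sub_pos.2 hst
    rw [segment_eq_image']
    refine ⟨(x - X s) / (X t - X s), ⟨div_nonneg (by linarith) h3.le,
      (div_le_one h3).2 (by linarith)⟩, ?_⟩
    have h4 : (f t).1 + ε * (f t).2 - ((f s).1 + ε * (f s).2) ≠ 0 := h3.ne'
    ext
    · simp only [hXdef, hYdef, lineHeight, Prod.fst_add, Prod.smul_fst, Prod.fst_sub, smul_eq_mul]
      field_simp
      ring
    · simp only [hXdef, hYdef, lineHeight, Prod.snd_add, Prod.smul_snd, Prod.snd_sub, smul_eq_mul]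
      field_simp
  set D : Finset (V × V) := Finset.univ.filter fun e => G.Adj e.1 e.2 ∧ X e.1 < X e.2 with hD
  have hDmem : ∀ e : V × V, e ∈ D ↔ G.Adj e.1 e.2 ∧ X e.1 < X e.2 := by simp [hD]
  have hP : IsPlaneEdgeSet X Y (D : Set (V × V)) := by
    refine ⟨fun e he => ((hDmem e).1 he).2, ?_⟩
    rintro ⟨s, t⟩ he ⟨s', t'⟩ he' hne x h1 h2 h1' h2' heq
    obtain ⟨hst, hlt⟩ := (hDmem _).1 he
    obtain ⟨hst', hlt'⟩ := (hDmem _).1 he'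
    have hne' : s(s, t) ≠ s(s', t') := by
      intro h
      rcases Sym2.eq_iff.1 h with ⟨rfl, rfl⟩ | ⟨rfl, rfl⟩
      · exact hne rfl
      · exact lt_asymm hlt hlt'
    have hmem := Set.mem_inter (hseg s t x hlt h1 h2) (by
      rw [show lineHeight X Y s t x = lineHeight X Y s' t' x from heq]
      exact hseg s' t' x hlt' h1' h2')
    rw [hf.2 s t s' t' hst hst' hne'] at hmem
    obtain ⟨v, ⟨hv, hv'⟩, hvx⟩ := hmem
    refine ⟨v, hv, hv', ?_⟩
    simp only [hXdef, hvx]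
    ring
  obtain ⟨n, L, E, hd, -, hE, -⟩ := hP.exists_disc hX hab _ Finset.univ D rfl (by simp) (by simp)
    (fun v _ => ⟨ha v (by simp), hb v (by simp)⟩) (by simp)
  refine ⟨n, L, E, by simpa using hd, ?_⟩
  intro u v huv
  rcases lt_or_gt_of_ne (fun h => huv.ne (hX h) : X u ≠ X v) with h | h
  · exact hE (u, v) ((hDmem _).2 ⟨huv, h⟩)
  · rw [Sym2.eq_swap]
    exact hE (v, u) ((hDmem _).2 ⟨huv.symm, h⟩)

/-- Twice the signed area of the triangle `pqr`. -/
def orient (p q r : ℝ × ℝ) : ℝ :=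
  (q.1 - p.1) * (r.2 - p.2) - (q.2 - p.2) * (r.1 - p.1)

/-- In a drawing without collinear triples, only disjoint edges can cross. -/
theorem isCrossingFreeDrawing_of_orient_ne_zero {V : Type*} {G : SimpleGraph V} {f : V → ℝ × ℝ}
    (hf : Function.Injective f)
    (hgen : ∀ u v w, u ≠ v → u ≠ w → v ≠ w → orient (f u) (f v) (f w) ≠ 0)
    (hdis : ∀ a b c d, G.Adj a b → G.Adj c d → a ≠ c → a ≠ d → b ≠ c → b ≠ d →
      Disjoint (segment ℝ (f a) (f b)) (segment ℝ (f c) (f d))) :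
    IsCrossingFreeDrawing G f := by
  have shared : ∀ a b c, G.Adj a b → G.Adj a c → b ≠ c →
      segment ℝ (f a) (f b) ∩ segment ℝ (f a) (f c) = f '' (({a, b} : Set V) ∩ {a, c}) := by
    intro a b c hab hac hbc
    have h1 : ({a, b} : Set V) ∩ {a, c} = {a} := by
      have := hab.ne
      ext u
      simp only [Set.mem_inter_iff, Set.mem_insert_iff, Set.mem_singleton_iff]
      constructor
      · rintro ⟨rfl | rfl, h | h⟩
        · rfl
        · rfl
        · exact h
        · exact absurd h hbc
      · rintro rfl
        exact ⟨Or.inl rfl, Or.inl rfl⟩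
    rw [h1, Set.image_singleton]
    apply Set.Subset.antisymm
    · rintro z ⟨hz₁, hz₂⟩
      rw [segment_eq_image'] at hz₁ hz₂
      obtain ⟨s, -, rfl⟩ := hz₁
      obtain ⟨t, -, ht⟩ := hz₂
      have e₁ := congrArg Prod.fst ht
      have e₂ := congrArg Prod.snd ht
      simp only [Prod.fst_add, Prod.smul_fst, Prod.fst_sub, smul_eq_mul, Prod.snd_add,
        Prod.smul_snd, Prod.snd_sub] at e₁ e₂
      have h2 : s * orient (f a) (f b) (f c) = 0 := by
        unfold orient
        linear_combination ((f c).1 - (f a).1) * e₂ - ((f c).2 - (f a).2) * e₁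
      rcases mul_eq_zero.1 h2 with rfl | h3
      · simp
      · exact absurd h3 (hgen a b c hab.ne hac.ne hbc)
    · rintro _ rfl
      exact ⟨left_mem_segment ℝ _ _, left_mem_segment ℝ _ _⟩
  refine ⟨hf, fun a b c d hab hcd hne => ?_⟩
  by_cases h1 : a = c
  · subst h1
    exact shared a b d hab hcd (by rintro rfl; exact hne rfl)
  by_cases h2 : a = d
  · subst h2
    rw [segment_symm ℝ (f c), Set.pair_comm c]
    exact shared a b c hab hcd.symm (by rintro rfl; exact hne Sym2.eq_swap)
  by_cases h3 : b = c
  · subst h3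
    rw [segment_symm ℝ (f a), Set.pair_comm a]
    exact shared b a d hab.symm hcd h2
  by_cases h4 : b = d
  · subst h4
    rw [segment_symm ℝ (f a), Set.pair_comm a, segment_symm ℝ (f c), Set.pair_comm c]
    exact shared b a c hab.symm hcd.symm h1
  rw [(hdis a b c d hab hcd h1 h2 h3 h4).inter_eq, Disjoint.inter_eq, Set.image_empty]
  rw [Set.disjoint_left]
  rintro u (rfl | rfl) (h | h)
  · exact h1 h
  · exact h2 h
  · exact h3 h
  · exact h4 h

theorem disjoint_segment_of_lt {a b c d : ℝ × ℝ} (φ : ℝ × ℝ →ₗ[ℝ] ℝ) (hac : φ a < φ c)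
    (had : φ a < φ d) (hbc : φ b < φ c) (hbd : φ b < φ d) :
    Disjoint (segment ℝ a b) (segment ℝ c d) := by
  rw [Set.disjoint_left]
  rintro z ⟨s, t, hs, ht, hst, rfl⟩ ⟨s', t', hs', ht', hst', h⟩
  have h1 := congrArg φ h
  simp only [map_add, map_smul, smul_eq_mul] at h1
  have e₁ : s * φ a + t * φ b ≤ max (φ a) (φ b) := by
    calc _ ≤ s * max (φ a) (φ b) + t * max (φ a) (φ b) :=
          add_le_add (mul_le_mul_of_nonneg_left (le_max_left _ _) hs)
            (mul_le_mul_of_nonneg_left (le_max_right _ _) ht)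
      _ = _ := by rw [← add_mul, hst, one_mul]
  have e₂ : min (φ c) (φ d) ≤ s' * φ c + t' * φ d := by
    calc _ = s' * min (φ c) (φ d) + t' * min (φ c) (φ d) := by rw [← add_mul, hst', one_mul]
      _ ≤ _ := add_le_add (mul_le_mul_of_nonneg_left (min_le_left _ _) hs')
            (mul_le_mul_of_nonneg_left (min_le_right _ _) ht')
  have e₃ : max (φ a) (φ b) < min (φ c) (φ d) :=
    max_lt (lt_min hac had) (lt_min hbc hbd)
  linarith

/-- If, for every edge and every further vertex, one of three functionals is larger at the vertex
than on the edge, then disjoint edges do not cross. -/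
theorem disjoint_segment_of_functionals {V : Type*} {G : SimpleGraph V} {f : V → ℝ × ℝ}
    (φ : Fin 3 → ℝ × ℝ →ₗ[ℝ] ℝ)
    (h : ∀ a b w, G.Adj a b → w ≠ a → w ≠ b →
      ∃ i, φ i (f a) < φ i (f w) ∧ φ i (f b) < φ i (f w))
    (a b c d : V) (hab : G.Adj a b) (hcd : G.Adj c d) (hac : a ≠ c) (had : a ≠ d) (hbc : b ≠ c)
    (hbd : b ≠ d) : Disjoint (segment ℝ (f a) (f b)) (segment ℝ (f c) (f d)) := by
  obtain ⟨i, hi₁, hi₂⟩ := h a b c hab hac.symm hbc.symm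
  obtain ⟨j, hj₁, hj₂⟩ := h a b d hab had.symm hbd.symm
  obtain ⟨k, hk₁, hk₂⟩ := h c d a hcd hac had
  obtain ⟨l, hl₁, hl₂⟩ := h c d b hcd hbc hbd
  have hik : i ≠ k := by rintro rfl; linarith
  have hil : i ≠ l := by rintro rfl; linarith
  have hjk : j ≠ k := by rintro rfl; linarith
  have hjl : j ≠ l := by rintro rfl; linarith
  have hij : i = j ∨ k = l := by omega
  rcases hij with rfl | rfl
  · exact disjoint_segment_of_lt (φ i) hi₁ hj₁ hi₂ hj₂
  · exact (disjoint_segment_of_lt (φ k) hk₁ hl₁ hk₂ hl₂).symm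

theorem orient_ne_zero_of_modEq_sq {p : ℕ} (hp : p.Prime) {x₁ x₂ x₃ k₁ k₂ k₃ : ℤ}
    (h₁₂ : x₁ ≠ x₂) (h₁₃ : x₁ ≠ x₃) (h₂₃ : x₂ ≠ x₃) (h₁ : 0 ≤ x₁ ∧ x₁ < p)
    (h₂ : 0 ≤ x₂ ∧ x₂ < p) (h₃ : 0 ≤ x₃ ∧ x₃ < p) :
    orient ((x₁ : ℝ), ((x₁ ^ 2 + p * k₁ : ℤ) : ℝ)) ((x₂ : ℝ), ((x₂ ^ 2 + p * k₂ : ℤ) : ℝ))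
      ((x₃ : ℝ), ((x₃ ^ 2 + p * k₃ : ℤ) : ℝ)) ≠ 0 := by
  intro h
  unfold orient at h
  simp only at h
  have h' : (x₂ - x₁) * ((x₃ ^ 2 + p * k₃) - (x₁ ^ 2 + p * k₁)) -
      ((x₂ ^ 2 + p * k₂) - (x₁ ^ 2 + p * k₁)) * (x₃ - x₁) = 0 := by exact_mod_cast h
  have hdvd : (p : ℤ) ∣ (x₂ - x₁) * (x₃ - x₁) * (x₃ - x₂) :=
    ⟨(k₂ - k₁) * (x₃ - x₁) - (x₂ - x₁) * (k₃ - k₁), by linear_combination h'⟩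
  have hp' := Nat.prime_iff_prime_int.1 hp
  have key : ∀ x y : ℤ, x ≠ y → (0 ≤ x ∧ x < p) → (0 ≤ y ∧ y < p) → ¬ (p : ℤ) ∣ x - y := by
    intro x y hxy hx hy hd
    exact hxy (sub_eq_zero.1 (Int.eq_zero_of_abs_lt_dvd hd (abs_lt.2 ⟨by omega, by omega⟩)))
  rcases hp'.dvd_or_dvd hdvd with h4 | h4
  · rcases hp'.dvd_or_dvd h4 with h5 | h5
    · exact key _ _ h₁₂.symm h₂ h₁ h5
    · exact key _ _ h₁₃.symm h₃ h₁ h5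
  · exact key _ _ h₂₃.symm h₃ h₂ h4

/-- A Schnyder drawing can be perturbed and scaled to a grid drawing without collinear triples. -/
theorem IsSchnyder.exists_gridDrawing {n : ℕ} (hn : 1 ≤ n) {G : SimpleGraph (Fin n)}
    {L : List (Fin n)} {E : Set (Sym2 (Fin n))} {A B : Fin n → ℤ} {r : Fin n → ℚ}
    (h : IsSchnyder L Set.univ E A B r) (hG : ∀ u v, G.Adj u v → s(u, v) ∈ E) :
    ∃ f : Fin n → ℝ × ℝ, IsCrossingFreeDrawing G f ∧
      (∀ u v, u ≠ v → (f u).1 ≠ (f v).1) ∧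
      (∀ u v w, u ≠ v → u ≠ w → v ≠ w → orient (f u) (f v) (f w) ≠ 0) ∧
      ∀ v, ∃ a b : ℤ, f v = ((a : ℝ), (b : ℝ)) ∧ 0 ≤ a ∧ (a : ℝ) ≤ 50 * (n : ℝ) ^ 2 ∧
        0 ≤ b ∧ (b : ℝ) ≤ 50 * (n : ℝ) ^ 3 := by
  obtain ⟨p, hp, hlt, hle⟩ := Nat.exists_prime_lt_and_le_two_mul (5 * n ^ 2) (by positivity)
  have hbound : ∀ v, 0 ≤ A v ∧ A v ≤ 2 * n ∧ 0 ≤ B v ∧ B v ≤ 2 * n := by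
    intro v
    have := h.bound v (Set.mem_univ v)
    simpa [Set.ncard_univ] using this
  set x : Fin n → ℤ := fun v => 2 * n * A v + (v : ℕ) with hx
  set y : Fin n → ℤ := fun v => 2 * p * B v + x v ^ 2 % p with hy
  have hn' : (1 : ℤ) ≤ n := by exact_mod_cast hn
  have hp0 : (0 : ℤ) < p := by exact_mod_cast hp.pos
  have hlt' : 5 * (n : ℤ) ^ 2 < p := by exact_mod_cast hlt
  have hle' : (p : ℤ) ≤ 2 * (5 * (n : ℤ) ^ 2) := by exact_mod_cast hle
  have hv : ∀ v : Fin n, ((v : ℕ) : ℤ) + 1 ≤ n := fun v => by exact_mod_cast v.2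
  have hv0 : ∀ v : Fin n, 0 ≤ ((v : ℕ) : ℤ) := fun v => by positivity
  have hx0 : ∀ v, 0 ≤ x v := fun v => by
    have := (hbound v).1
    simp only [hx]
    positivity
  have hx5 : ∀ v, x v ≤ 5 * (n : ℤ) ^ 2 := by
    intro v
    simp only [hx]
    nlinarith [hbound v, hv v]
  have hη0 : ∀ v, 0 ≤ x v ^ 2 % p := fun v => Int.emod_nonneg _ hp0.ne'
  have hηp : ∀ v, x v ^ 2 % p < p := fun v => Int.emod_lt_of_pos _ hp0
  have hxinj : Function.Injective x := by
    intro u v huv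
    have h1 : x u % (2 * n) = x v % (2 * n) := by rw [huv]
    simp only [hx, Int.mul_add_emod_self_left] at h1
    rw [Int.emod_eq_of_lt (hv0 u) (by linarith [hv u]), Int.emod_eq_of_lt (hv0 v) (by linarith [hv v])] at h1
    exact Fin.ext (by exact_mod_cast h1)
  have hyk : ∀ v, y v = x v ^ 2 + p * (2 * B v - x v ^ 2 / p) := by
    intro v
    have := Int.mul_ediv_add_emod (x v ^ 2) p
    simp only [hy]
    linear_combination this
  have hgen : ∀ u v w, u ≠ v → u ≠ w → v ≠ w →
      orient ((x u : ℝ), (y u : ℝ)) ((x v : ℝ), (y v : ℝ)) ((x w : ℝ), (y w : ℝ)) ≠ 0 := by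
    intro u v w huv huw hvw
    rw [hyk u, hyk v, hyk w]
    exact orient_ne_zero_of_modEq_sq hp (hxinj.ne huv) (hxinj.ne huw) (hxinj.ne hvw)
      ⟨hx0 u, by linarith [hx5 u]⟩ ⟨hx0 v, by linarith [hx5 v]⟩ ⟨hx0 w, by linarith [hx5 w]⟩
  have hx1 : ∀ u v, u ≠ v → ((x u : ℝ), (y u : ℝ)).1 ≠ ((x v : ℝ), (y v : ℝ)).1 := by
    intro u v huv
    simpa using hxinj.ne huv
  refine ⟨fun v => ((x v : ℝ), (y v : ℝ)), ?_, hx1, hgen, ?_⟩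
  · refine isCrossingFreeDrawing_of_orient_ne_zero (fun u v huv => ?_) hgen
      (disjoint_segment_of_functionals ![LinearMap.fst ℝ ℝ ℝ, LinearMap.snd ℝ ℝ ℝ,
        -((p : ℝ) • LinearMap.fst ℝ ℝ ℝ) - (n : ℝ) • LinearMap.snd ℝ ℝ ℝ] ?_)
    · by_contra hne
      exact hx1 u v hne (congrArg Prod.fst huv)
    · intro a b w hab hwa hwb
      have hA : ∀ s, A s < A w → x s < x w := by
        intro s hs
        simp only [hx]
        nlinarith [hv s, hv0 w, mul_le_mul_of_nonneg_left (Int.add_one_le_iff.2 hs) (by linarith : (0 : ℤ) ≤ 2 * n)]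
      have hB : ∀ s, B s < B w → y s < y w := by
        intro s hs
        simp only [hy]
        nlinarith [hηp s, hη0 w, mul_le_mul_of_nonneg_left (Int.add_one_le_iff.2 hs) (by linarith : (0 : ℤ) ≤ 2 * p)]
      have hC : ∀ s, A w + B w < A s + B s → p * x w + n * y w < p * x s + n * y s := by
        intro s hs
        have h1 := mul_le_mul_of_nonneg_left (Int.add_one_le_iff.2 hs)
          (by positivity : (0 : ℤ) ≤ 2 * n * p)
        have h2 := mul_lt_mul_of_pos_left (Int.add_one_le_iff.1 (hv w)) hp0
        have h3 := mul_le_mul_of_nonneg_left (hηp w).le (by linarith : (0 : ℤ) ≤ n)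
        have h4 := mul_nonneg hp0.le (hv0 s)
        have h5 := mul_nonneg (by linarith : (0 : ℤ) ≤ n) (hη0 s)
        simp only [hx, hy] at *
        nlinarith
      rcases h.empty a b w (hG a b hab) (Set.mem_univ w) hwa hwb with h1 | h1 | h1
      · refine ⟨0, ?_, ?_⟩
        · simpa using hA a h1.1
        · simpa using hA b h1.2.1
      · refine ⟨1, ?_, ?_⟩
        · simpa using hB a h1.1
        · simpa using hB b h1.2.1
      · have h2 : ((p * x w + n * y w : ℤ) : ℝ) < ((p * x a + n * y a : ℤ) : ℝ) := by
          exact_mod_cast hC a h1.1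
        have h3 : ((p * x w + n * y w : ℤ) : ℝ) < ((p * x b + n * y b : ℤ) : ℝ) := by
          exact_mod_cast hC b h1.2
        push_cast at h2 h3
        refine ⟨2, ?_, ?_⟩
        · simp; linarith
        · simp; linarith
  · intro v
    refine ⟨x v, y v, rfl, hx0 v, ?_, ?_, ?_⟩
    · have : (x v : ℝ) ≤ 5 * (n : ℝ) ^ 2 := by exact_mod_cast hx5 v
      nlinarith [sq_nonneg (n : ℝ)]
    · have := (hbound v).2.2.1
      have := hη0 v
      simp only [hy]
      positivity
    · have h1 : y v ≤ 50 * (n : ℤ) ^ 3 := by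
        have h2 : y v ≤ 2 * p * (2 * n) + p := by
          have := mul_le_mul_of_nonneg_left (hbound v).2.2.2 (by linarith : (0 : ℤ) ≤ 2 * p)
          simp only [hy]
          linarith [hηp v]
        have h3 : (p : ℤ) * (4 * n + 1) ≤ 2 * (5 * (n : ℤ) ^ 2) * (4 * n + 1) :=
          mul_le_mul_of_nonneg_right hle' (by linarith)
        nlinarith [mul_le_mul_of_nonneg_left hn' (sq_nonneg (n : ℤ))]
      exact_mod_cast h1

/-- No three distinct points of `s` are collinear. -/
def NoCollinearTriple (s : Set (ℝ × ℝ)) : Prop :=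
  ∀ u ∈ s, ∀ v ∈ s, ∀ w ∈ s, u ≠ v → u ≠ w → v ≠ w → orient u v w ≠ 0

theorem NoCollinearTriple.mono {s t : Set (ℝ × ℝ)} (h : NoCollinearTriple t) (hst : s ⊆ t) :
    NoCollinearTriple s :=
  fun u hu v hv w hw => h u (hst hu) v (hst hv) w (hst hw)

theorem Finset.exists_smallest {α : Type*} [DecidableEq α] (X : Finset α) (key : α → ℝ)
    (hinj : Set.InjOn key X) : ∀ k ≤ X.card, ∃ U ⊆ X, U.card = k ∧
      ∀ u ∈ U, ∀ w ∈ X, w ∉ U → key u < key w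
  | 0, _ => ⟨∅, by simp, rfl, by simp⟩
  | k + 1, hk => by
    obtain ⟨U, hU, hc, hlt⟩ := Finset.exists_smallest X key hinj k (by omega)
    obtain ⟨m, hm, hmin⟩ := (X \ U).exists_min_image key (by
      rw [← Finset.card_pos, Finset.card_sdiff_of_subset hU]; omega)
    obtain ⟨hmX, hmU⟩ := Finset.mem_sdiff.1 hm
    refine ⟨insert m U, Finset.insert_subset hmX hU, by rw [Finset.card_insert_of_notMem hmU, hc], ?_⟩
    intro u hu w hw hwU
    have hw' : w ≠ m ∧ w ∉ U := by simpa using hwU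
    rcases Finset.mem_insert.1 hu with rfl | hu
    · exact (hmin w (Finset.mem_sdiff.2 ⟨hw, hw'.2⟩)).lt_of_ne fun h => hw'.1 (hinj hmX hw h).symm
    · exact hlt u hu w hw hw'.2

/-- The scalar product of `s - p` and `q - p`, divided by the distance of `s` from the line `pq`. -/
noncomputable def cotKey (p q s : ℝ × ℝ) : ℝ :=
  ((s.1 - p.1) * (q.1 - p.1) + (s.2 - p.2) * (q.2 - p.2)) / |orient p q s|

theorem orient_swap (p q r : ℝ × ℝ) : orient q p r = -orient p q r := by
  unfold orient; ring

theorem normSq_pos {p q : ℝ × ℝ} (h : p ≠ q) : 0 < (q.1 - p.1) ^ 2 + (q.2 - p.2) ^ 2 := by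
  by_contra! h'
  have h1 : q.1 - p.1 = 0 := by nlinarith [sq_nonneg (q.1 - p.1), sq_nonneg (q.2 - p.2)]
  have h2 : q.2 - p.2 = 0 := by nlinarith [sq_nonneg (q.1 - p.1), sq_nonneg (q.2 - p.2)]
  exact h (Prod.ext (by linarith) (by linarith))

theorem cotKey_le_iff_left {p q s r : ℝ × ℝ} (hpq : p ≠ q) (hs : 0 < orient p q s)
    (hr : 0 < orient p q r) : cotKey p q s ≤ cotKey p q r ↔ 0 ≤ orient p r s := by
  unfold cotKey
  rw [abs_of_pos hs, abs_of_pos hr, div_le_div_iff₀ hs hr, ← sub_nonneg]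
  have : ∀ x : ℝ, 0 ≤ x ↔ 0 ≤ ((q.1 - p.1) ^ 2 + (q.2 - p.2) ^ 2) * x :=
    fun x => (mul_nonneg_iff_of_pos_left (normSq_pos hpq)).symm
  rw [this (orient p r s)]
  unfold orient
  constructor <;> intro h <;> nlinarith

theorem cotKey_le_iff_right {p q s r : ℝ × ℝ} (hpq : p ≠ q) (hs : 0 < orient p q s)
    (hr : 0 < orient p q r) : cotKey q p s ≤ cotKey q p r ↔ 0 ≤ orient r q s := by
  have hs' := orient_swap p q s
  have hr' := orient_swap p q r
  unfold cotKey
  rw [hs', hr', abs_neg, abs_neg, abs_of_pos hs, abs_of_pos hr, div_le_div_iff₀ hs hr,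
    ← sub_nonneg]
  have : ∀ x : ℝ, 0 ≤ x ↔ 0 ≤ ((q.1 - p.1) ^ 2 + (q.2 - p.2) ^ 2) * x :=
    fun x => (mul_nonneg_iff_of_pos_left (normSq_pos hpq)).symm
  rw [this (orient r q s)]
  unfold orient
  constructor <;> intro h <;> nlinarith

/-- The linear part of `orient p (p + d)`. -/
def crossMap (d : ℝ × ℝ) : ℝ × ℝ →ₗ[ℝ] ℝ :=
  d.1 • LinearMap.snd ℝ ℝ ℝ - d.2 • LinearMap.fst ℝ ℝ ℝ

theorem crossMap_apply (d z : ℝ × ℝ) : crossMap d z = d.1 * z.2 - d.2 * z.1 := by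
  simp [crossMap]

/-- Points to the left of `pq` can be divided in any prescribed proportion by a line through one of
them such that the two parts lie to the left of `pr` and of `rq`. -/
theorem exists_split {p q : ℝ × ℝ} (hpq : p ≠ q) {S : Finset (ℝ × ℝ)}
    (hleft : ∀ s ∈ S, 0 < orient p q s)
    (hgen : NoCollinearTriple (insert p (insert q (S : Set (ℝ × ℝ))))) {k₁ k₂ : ℕ}
    (hcard : S.card = k₁ + k₂ + 1) :
    ∃ r ∈ S, ∃ S₁ ⊆ S.erase r, S₁.card = k₁ ∧ ∃ φ : ℝ × ℝ →ₗ[ℝ] ℝ, φ r < φ p ∧ φ q < φ r ∧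
      (∀ s ∈ S₁, 0 < orient p r s ∧ φ r < φ s) ∧
      ∀ s ∈ S.erase r, s ∉ S₁ → 0 < orient r q s ∧ φ s < φ r := by
  classical
  have hp : ∀ s ∈ S, s ≠ p := by
    rintro s hs rfl
    have := hleft s hs
    unfold orient at this
    linarith
  have hq : ∀ s ∈ S, s ≠ q := by
    rintro s hs rfl
    have := hleft s hs
    unfold orient at this
    linarith
  have hpm : p ∈ insert p (insert q (S : Set (ℝ × ℝ))) := by simp
  have hqm : q ∈ insert p (insert q (S : Set (ℝ × ℝ))) := by simp
  have hsm : ∀ s ∈ S, s ∈ insert p (insert q (S : Set (ℝ × ℝ))) := by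
    intro s hs
    exact Or.inr (Or.inr hs)
  have hgp : ∀ s ∈ S, ∀ r ∈ S, s ≠ r → orient p r s ≠ 0 := fun s hs r hr h =>
    hgen p hpm r (hsm r hr) s (hsm s hs) (hp r hr).symm (hp s hs).symm h.symm
  have hgq : ∀ s ∈ S, ∀ r ∈ S, s ≠ r → orient r q s ≠ 0 := fun s hs r hr h =>
    hgen r (hsm r hr) q hqm s (hsm s hs) (hq r hr) h.symm (hq s hs).symm
  obtain ⟨T, hT, hTc, hTlt⟩ := Finset.exists_smallest S (fun s => -cotKey q p s) (by
    intro s hs t ht hst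
    by_contra hne
    have hst' : cotKey q p s = cotKey q p t := neg_injective hst
    have h1 := (cotKey_le_iff_right hpq (hleft s hs) (hleft t ht)).1 hst'.le
    have h2 := (cotKey_le_iff_right hpq (hleft t ht) (hleft s hs)).1 hst'.ge
    apply hgq s hs t ht hne
    have : orient s q t = - orient t q s := by unfold orient; ring
    linarith) (k₁ + 1) (by omega)
  obtain ⟨r, hrT, hrmax⟩ := T.exists_max_image (cotKey p q) (by
    rw [← Finset.card_pos]; omega)
  have hr := hT hrT
  have hr0 := hleft r hr
  set X := (S.erase r).filter fun s => 0 < orient p r s with hX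
  have hXmem : ∀ s, s ∈ X ↔ (s ≠ r ∧ s ∈ S) ∧ 0 < orient p r s := by simp [hX]
  have hTX : T.erase r ⊆ X := by
    intro s hs
    obtain ⟨hsr, hsT⟩ := Finset.mem_erase.1 hs
    refine (hXmem s).2 ⟨⟨hsr, hT hsT⟩, ?_⟩
    exact ((cotKey_le_iff_left hpq (hleft s (hT hsT)) hr0).1 (hrmax s hsT)).lt_of_ne
      (hgp s (hT hsT) r hr hsr).symm
  have hTr : (T.erase r).card = k₁ := by rw [Finset.card_erase_of_mem hrT]; omega
  have hneg : ∀ s ∈ S, s ≠ r → orient r q s < 0 → s ∈ T.erase r := by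
    intro s hs hsr h
    refine Finset.mem_erase.2 ⟨hsr, ?_⟩
    by_contra hsT
    have h1 := hTlt r hrT s hs hsT
    have h2 := (cotKey_le_iff_right hpq (hleft s hs) hr0).1 (by linarith)
    linarith
  obtain ⟨U, hUX, hUc, hUlt⟩ := Finset.exists_smallest X
    (fun s => orient r q s / orient p r s) (by
      intro s hs t ht hst
      obtain ⟨⟨hsr, hsS⟩, hs0⟩ := (hXmem s).1 hs
      obtain ⟨⟨htr, htS⟩, ht0⟩ := (hXmem t).1 ht
      by_contra hne
      simp only at hst
      rw [div_eq_div_iff hs0.ne' ht0.ne'] at hst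
      have h1 : orient p q r * orient r s t = 0 := by
        unfold orient at hst ⊢
        linear_combination hst
      rcases mul_eq_zero.1 h1 with h2 | h2
      · exact hr0.ne' h2
      · exact hgen r (hsm r hr) s (hsm s hsS) t (hsm t htS) hsr.symm htr.symm hne h2) k₁
      (hTr ▸ Finset.card_le_card hTX)
  have hpos : ∀ w ∈ X, w ∉ U → 0 < orient r q w / orient p r w := by
    intro w hw hwU
    obtain ⟨⟨hwr, hwS⟩, hw0⟩ := (hXmem w).1 hw
    by_contra! h
    have hle : ∀ s ∈ insert w U, s ∈ T.erase r := by
      intro s hs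
      have hsX : s ∈ X := by
        rcases Finset.mem_insert.1 hs with rfl | hs
        · exact hw
        · exact hUX hs
      obtain ⟨⟨hsr, hsS⟩, hs0⟩ := (hXmem s).1 hsX
      have h1 : orient r q s / orient p r s ≤ 0 := by
        rcases Finset.mem_insert.1 hs with rfl | hs
        · exact h
        · exact (hUlt s hs w hw hwU).le.trans h
      refine hneg s hsS hsr (lt_of_le_of_ne ?_ (hgq s hsS r hr hsr))
      by_contra! h2
      exact absurd (div_pos h2 hs0) (not_lt.2 h1)
    have := Finset.card_le_card hle
    rw [Finset.card_insert_of_notMem hwU] at this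
    omega
  obtain ⟨σ, hσ₁, hσ₂⟩ := Order.exists_between_finsets
    (insert 0 (U.image fun s => orient r q s / orient p r s))
    ((X \ U).image fun s => orient r q s / orient p r s) (by
      intro x hx y hy
      obtain ⟨w, hw, rfl⟩ := Finset.mem_image.1 hy
      obtain ⟨hw, hwU⟩ := Finset.mem_sdiff.1 hw
      rcases Finset.mem_insert.1 hx with rfl | hx
      · exact hpos w hw hwU
      · obtain ⟨s, hs, rfl⟩ := Finset.mem_image.1 hx
        exact hUlt s hs w hw hwU)
  have hσ0 : 0 < σ := hσ₁ 0 (by simp)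
  have hφ : ∀ s, crossMap ((r.1 - q.1) - σ * (p.1 - r.1), (r.2 - q.2) - σ * (p.2 - r.2)) s -
      crossMap ((r.1 - q.1) - σ * (p.1 - r.1), (r.2 - q.2) - σ * (p.2 - r.2)) r =
      σ * orient p r s - orient r q s := by
    intro s
    simp only [crossMap_apply, orient]
    ring
  refine ⟨r, hr, U, ?_, hUc, crossMap ((r.1 - q.1) - σ * (p.1 - r.1), (r.2 - q.2) - σ * (p.2 - r.2)),
    ?_, ?_, ?_, ?_⟩
  · intro s hs
    have := (hXmem s).1 (hUX hs)
    exact Finset.mem_erase.2 this.1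
  · have h1 := hφ p
    have h2 : orient p r p = 0 := by unfold orient; ring
    have h3 : orient r q p = -orient p q r := by unfold orient; ring
    rw [h2, h3] at h1
    linarith
  · have h1 := hφ q
    have h2 : orient p r q = -orient p q r := by unfold orient; ring
    have h3 : orient r q q = 0 := by unfold orient; ring
    rw [h2, h3] at h1
    nlinarith [mul_pos hσ0 hr0]
  · intro s hs
    obtain ⟨⟨hsr, hsS⟩, hs0⟩ := (hXmem s).1 (hUX hs)
    refine ⟨hs0, ?_⟩
    have h1 := hσ₁ _ (Finset.mem_insert_of_mem (Finset.mem_image_of_mem _ hs))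
    rw [div_lt_iff₀ hs0] at h1
    linarith [hφ s]
  · intro s hs hsU
    obtain ⟨hsr, hsS⟩ := Finset.mem_erase.1 hs
    by_cases hsX : s ∈ X
    · have hs0 := ((hXmem s).1 hsX).2
      have h1 := hσ₂ _ (Finset.mem_image_of_mem _ (Finset.mem_sdiff.2 ⟨hsX, hsU⟩))
      rw [lt_div_iff₀ hs0] at h1
      refine ⟨by nlinarith [mul_pos hσ0 hs0], by linarith [hφ s]⟩
    · have h1 : orient p r s < 0 := by
        refine lt_of_le_of_ne ?_ (hgp s hsS r hr hsr)
        by_contra! h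
        exact hsX ((hXmem s).2 ⟨⟨hsr, hsS⟩, h⟩)
      have h2 : 0 < orient r q s := by
        refine lt_of_le_of_ne ?_ (hgq s hsS r hr hsr).symm
        by_contra! h
        exact hsX (hTX (hneg s hsS hsr h))
      exact ⟨h2, by nlinarith [hφ s, mul_pos hσ0 (neg_pos.2 h1)]⟩

/-- Two edges of the form `i < j` of an outerplanar ordering do not interleave. -/
def IsNonInterleaving (R : ℕ → ℕ → Prop) : Prop :=
  ∀ a c b d, a < c → c < b → b < d → R a b → R c d → False

/-- In every interval some inner vertex is only straddled by the edge joining the end points. -/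
theorem IsNonInterleaving.exists_cut {R : ℕ → ℕ → Prop} (h : IsNonInterleaving R) {i j : ℕ}
    (hij : i + 1 < j) : ∃ k, i < k ∧ k < j ∧
      ∀ a b, i ≤ a → b ≤ j → R a b → a < k → k < b → a = i ∧ b = j := by
  classical
  by_cases hne : ∃ k, i < k ∧ k < j ∧ R i k
  · obtain ⟨k, hk, hmax⟩ := ((Finset.Ioo i j).filter fun k => R i k).exists_max_image id (by
      obtain ⟨k, h1, h2, h3⟩ := hne
      exact ⟨k, by simp [h1, h2, h3]⟩)
    simp only [Finset.mem_filter, Finset.mem_Ioo, id] at hk hmax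
    refine ⟨k, hk.1.1, hk.1.2, fun a b ha hb hR hak hkb => ?_⟩
    rcases ha.eq_or_lt with rfl | ha
    · refine ⟨rfl, ?_⟩
      by_contra hbj
      have := hmax b ⟨⟨by omega, by omega⟩, hR⟩
      omega
    · exact absurd (h i a k b ha hak hkb hk.2 hR) id
  · refine ⟨i + 1, by omega, hij, fun a b ha hb hR hak hkb => ?_⟩
    obtain rfl : a = i := by omega
    refine ⟨rfl, ?_⟩
    by_contra hbj
    exact hne ⟨b, by omega, by omega, hR⟩

/-- An outerplanar graph can be drawn on any point set without collinear triples, with a prescribed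
edge of the convex hull for the pair of extreme vertices. -/
theorem IsNonInterleaving.exists_drawing {R : ℕ → ℕ → Prop} (h : IsNonInterleaving R) :
    ∀ (m i : ℕ) (p q : ℝ × ℝ) (S : Finset (ℝ × ℝ)), S.card = m → p ≠ q →
    (∀ s ∈ S, 0 < orient p q s) → NoCollinearTriple (insert p (insert q (S : Set (ℝ × ℝ)))) →
    ∃ f : ℕ → ℝ × ℝ, f i = p ∧ f (i + m + 1) = q ∧
      Set.BijOn f (Set.Ioo i (i + m + 1)) S ∧
      ∀ a b c d, i ≤ a → a < b → b ≤ i + m + 1 → i ≤ c → c < d → d ≤ i + m + 1 → R a b → R c d →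
        a ≠ c → a ≠ d → b ≠ c → b ≠ d →
        Disjoint (segment ℝ (f a) (f b)) (segment ℝ (f c) (f d)) := by
  classical
  intro m
  induction m using Nat.strong_induction_on with
  | _ m IH =>
    intro i p q S hS hpq hleft hgen
    rcases Nat.eq_zero_or_pos m with rfl | hm
    · refine ⟨fun a => if a = i then p else q, by simp, by simp, ?_, fun a b c d => by omega⟩
      rw [Finset.card_eq_zero] at hS
      subst hS
      have : Set.Ioo i (i + 0 + 1) = ∅ :=
        Set.eq_empty_of_forall_notMem fun x hx => by
          have h1 := hx.1
          have h2 := hx.2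
          omega
      rw [this]
      simp
    obtain ⟨k, hik, hkj, hcut⟩ := h.exists_cut (i := i) (j := i + m + 1) (by omega)
    obtain ⟨r, hr, S₁, hS₁, hc₁, φ, hφp, hφq, h₁, h₂⟩ := exists_split hpq hleft hgen
      (k₁ := k - i - 1) (k₂ := m - (k - i)) (by omega)
    have hS₂ : ((S.erase r) \ S₁).card = m - (k - i) := by
      rw [Finset.card_sdiff_of_subset hS₁, Finset.card_erase_of_mem hr]; omega
    have hpr : p ≠ r := by rintro rfl; exact lt_irrefl _ hφp
    have hrq : r ≠ q := by rintro rfl; exact lt_irrefl _ hφq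
    obtain ⟨f₁, hp₁, hr₁, hb₁, hd₁⟩ := IH (k - i - 1) (by omega) i p r S₁ hc₁ hpr
      (fun s hs => (h₁ s hs).1) (hgen.mono (by
        rintro s (rfl | rfl | hs)
        · simp
        · exact Or.inr (Or.inr hr)
        · exact Or.inr (Or.inr (Finset.mem_of_mem_erase (hS₁ hs)))))
    obtain ⟨f₂, hr₂, hq₂, hb₂, hd₂⟩ := IH (m - (k - i)) (by omega) k r q ((S.erase r) \ S₁) hS₂ hrq
      (fun s hs => (h₂ s (Finset.mem_sdiff.1 hs).1 (Finset.mem_sdiff.1 hs).2).1) (hgen.mono (by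
        rintro s (rfl | rfl | hs)
        · exact Or.inr (Or.inr hr)
        · exact Or.inr (Or.inl rfl)
        · exact Or.inr (Or.inr (Finset.mem_of_mem_erase (Finset.mem_sdiff.1 hs).1))))
    rw [show i + (k - i - 1) + 1 = k by omega] at hr₁ hb₁ hd₁
    rw [show k + (m - (k - i)) + 1 = i + m + 1 by omega] at hq₂ hb₂ hd₂
    set f : ℕ → ℝ × ℝ := fun a => if a ≤ k then f₁ a else f₂ a with hf
    have hf₁ : ∀ a, a ≤ k → f a = f₁ a := fun a ha => if_pos ha
    have hf₂ : ∀ a, k ≤ a → f a = f₂ a := by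
      intro a ha
      rcases ha.eq_or_lt with rfl | ha
      · rw [hf₁ _ le_rfl, hr₁, hr₂]
      · exact if_neg (by omega)
    have hfi : f i = p := by rw [hf₁ i hik.le, hp₁]
    have hfk : f k = r := by rw [hf₁ k le_rfl, hr₁]
    have hfj : f (i + m + 1) = q := by rw [hf₂ _ hkj.le, hq₂]
    have hlow : ∀ a, i ≤ a → a < k → φ r < φ (f a) := by
      intro a ha hak
      rcases ha.eq_or_lt with rfl | ha
      · rwa [hfi]
      · rw [hf₁ a hak.le]
        exact (h₁ _ (hb₁.mapsTo ⟨ha, hak⟩)).2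
    have hhigh : ∀ a, k < a → a ≤ i + m + 1 → φ (f a) < φ r := by
      intro a ha hak
      rcases hak.eq_or_lt with rfl | hak
      · rwa [hfj]
      · rw [hf₂ a ha.le]
        have := Finset.mem_sdiff.1 (hb₂.mapsTo ⟨ha, hak⟩)
        exact (h₂ _ this.1 this.2).2
    have hmaps : ∀ a, i < a → a < i + m + 1 → f a ∈ S := by
      intro a h1 h2
      rcases lt_trichotomy a k with h3 | rfl | h3
      · rw [hf₁ a h3.le]
        exact Finset.mem_of_mem_erase (hS₁ (hb₁.mapsTo ⟨h1, h3⟩))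
      · rwa [hfk]
      · rw [hf₂ a h3.le]
        exact Finset.mem_of_mem_erase (Finset.mem_sdiff.1 (hb₂.mapsTo ⟨h3, h2⟩)).1
    refine ⟨f, hfi, hfj, ⟨fun a ha => hmaps a ha.1 ha.2, ?_, ?_⟩, ?_⟩
    · have key : ∀ a b, i < a → a < b → b < i + m + 1 → f a ≠ f b := by
        intro a b ha hab hb heq
        rcases lt_or_ge b k with hbk | hbk
        · rw [hf₁ a (by omega), hf₁ b hbk.le] at heq
          exact hab.ne (hb₁.injOn ⟨ha, by omega⟩ ⟨by omega, hbk⟩ heq)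
        · rcases lt_or_ge k a with hak | hak
          · rw [hf₂ a hak.le, hf₂ b (by omega)] at heq
            exact hab.ne (hb₂.injOn ⟨hak, by omega⟩ ⟨by omega, hb⟩ heq)
          · have e₁ : φ r ≤ φ (f a) := by
              rcases hak.eq_or_lt with rfl | hak
              · rw [hfk]
              · exact (hlow a ha.le hak).le
            have e₂ : φ (f b) ≤ φ r := by
              rcases hbk.eq_or_lt with rfl | hbk
              · rw [hfk]
              · exact (hhigh b hbk hb.le).le
            rcases hak.eq_or_lt with rfl | hak
            · have := hhigh b hab hb.le
              rw [← heq, hfk] at this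
              exact lt_irrefl _ this
            · have := hlow a ha.le hak
              rw [heq] at this
              linarith
      intro a ha b hb hab
      rcases lt_trichotomy a b with h3 | h3 | h3
      · exact absurd hab (key a b ha.1 h3 hb.2)
      · exact h3
      · exact absurd hab.symm (key b a hb.1 h3 ha.2)
    · intro s hs
      rcases eq_or_ne s r with rfl | hsr
      · exact ⟨k, ⟨hik, hkj⟩, hfk⟩
      · by_cases hs₁ : s ∈ S₁
        · obtain ⟨a, ha, rfl⟩ := hb₁.surjOn hs₁
          exact ⟨a, ⟨ha.1, ha.2.trans hkj⟩, hf₁ a ha.2.le⟩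
        · obtain ⟨a, ha, rfl⟩ := hb₂.surjOn
            (Finset.mem_coe.2 (Finset.mem_sdiff.2 ⟨Finset.mem_erase.2 ⟨hsr, hs⟩, hs₁⟩))
          exact ⟨a, ⟨hik.trans ha.1, ha.2⟩, hf₂ a ha.1.le⟩
    · have hlow' : ∀ a, i ≤ a → a ≤ k → φ r ≤ φ (f a) := by
        intro a ha hak
        rcases hak.eq_or_lt with rfl | hak
        · rw [hfk]
        · exact (hlow a ha hak).le
      have hhigh' : ∀ a, k ≤ a → a ≤ i + m + 1 → φ (f a) ≤ φ r := by
        intro a ha hak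
        rcases ha.eq_or_lt with rfl | ha
        · rw [hfk]
        · exact (hhigh a ha hak).le
      have across : ∀ a b c d, i ≤ a → a < b → b ≤ k → k ≤ c → c < d → d ≤ i + m + 1 → b ≠ c →
          Disjoint (segment ℝ (f a) (f b)) (segment ℝ (f c) (f d)) := by
        intro a b c d ha hab hb hc hcd hd hbc
        rcases hb.eq_or_lt with rfl | hb
        · have e₁ := hlow' a ha (by omega)
          have e₂ := hlow' b (by omega) le_rfl
          have e₃ := hhigh c (by omega) (by omega)
          have e₄ := hhigh d (by omega) (by omega)
          exact (disjoint_segment_of_lt φ (e₃.trans_le e₁) (e₃.trans_le e₂) (e₄.trans_le e₁)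
            (e₄.trans_le e₂)).symm
        · have e₁ := hlow a ha (by omega)
          have e₂ := hlow b (by omega) hb
          have e₃ := hhigh' c hc (by omega)
          have e₄ := hhigh' d (by omega) hd
          exact (disjoint_segment_of_lt φ (e₃.trans_lt e₁) (e₃.trans_lt e₂) (e₄.trans_lt e₁)
            (e₄.trans_lt e₂)).symm
      have hull : ∀ c d, i < c → c < i + m + 1 → i < d → d < i + m + 1 →
          Disjoint (segment ℝ (f i) (f (i + m + 1))) (segment ℝ (f c) (f d)) := by
        intro c d hc₁ hc₂ hd₁ hd₂
        have e₁ : ∀ s, crossMap (q - p) s - crossMap (q - p) p = orient p q s := by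
          intro s
          simp only [crossMap_apply, orient, Prod.fst_sub, Prod.snd_sub]
          ring
        have e₂ := e₁ q
        rw [show orient p q q = 0 by unfold orient; ring] at e₂
        have e₃ := hleft _ (hmaps c hc₁ hc₂)
        have e₄ := hleft _ (hmaps d hd₁ hd₂)
        rw [hfi, hfj]
        rw [← e₁] at e₃ e₄
        exact disjoint_segment_of_lt (crossMap (q - p)) (by linarith) (by linarith) (by linarith)
          (by linarith)
      intro a b c d ha hab hb hc hcd hd hRab hRcd hac had hbc hbd
      have hcab := hcut a b ha hb hRab
      have hccd := hcut c d hc hd hRcd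
      by_cases h3 : a < k ∧ k < b
      · obtain ⟨rfl, rfl⟩ := hcab h3.1 h3.2
        exact hull c d (by omega) (by omega) (by omega) (by omega)
      by_cases h4 : c < k ∧ k < d
      · obtain ⟨rfl, rfl⟩ := hccd h4.1 h4.2
        exact (hull a b (by omega) (by omega) (by omega) (by omega)).symm
      rcases le_or_gt b k with hbk | hbk
      · rcases le_or_gt d k with hdk | hdk
        · rw [hf₁ a (by omega), hf₁ b hbk, hf₁ c (by omega), hf₁ d hdk]
          exact hd₁ a b c d ha hab hbk hc hcd hdk hRab hRcd hac had hbc hbd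
        · exact across a b c d ha hab hbk (by omega) hcd hd hbc
      · rcases le_or_gt d k with hdk | hdk
        · exact (across c d a b hc hcd hdk (by omega) hab hb had.symm).symm
        · rw [hf₂ a (by omega), hf₂ b hbk.le, hf₂ c (by omega), hf₂ d hdk.le]
          exact hd₂ a b c d (by omega) hab hb (by omega) hcd hd hRab hRcd hac had hbc hbd

/-- A strictly convex set has a cyclic order, which can be cut open at any of its points. -/
theorem InStrictlyConvexPosition.exists_key {V : Type*} [Finite V] {g : V → ℝ × ℝ}
    (hg : Function.Injective g) (hconv : InStrictlyConvexPosition (Set.range g)) (a : V) :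
    ∃ key : V → WithBot ℝ, Function.Injective key ∧
      ∀ u v w, key u < key v → key v < key w → 0 < orient (g u) (g v) (g w) := by
  classical
  have hhull : ∀ v (s : Set V), v ∉ s → g v ∉ convexHull ℝ (g '' s) := by
    intro v s hv h
    refine hconv (g v) ⟨v, rfl⟩ (convexHull_mono ?_ h)
    rintro _ ⟨w, hw, rfl⟩
    exact ⟨⟨w, rfl⟩, fun h => hv (hg h ▸ hw)⟩
  obtain ⟨φ, c, hφa, hφ⟩ := geometric_hahn_banach_point_closed (convex_convexHull ℝ _)
    (((Set.toFinite {v | v ≠ a}).image g).isClosed_convexHull ℝ) (hhull a {v | v ≠ a} (by simp))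
  have hpos : ∀ v, v ≠ a → 0 < φ (g v - g a) := by
    intro v hv
    have := hφ (g v) (subset_convexHull ℝ _ ⟨v, hv, rfl⟩)
    rw [map_sub]
    linarith
  have hφ' : ∀ z : ℝ × ℝ, φ z = z.1 * φ (1, 0) + z.2 * φ (0, 1) := by
    intro z
    have : z = z.1 • ((1 : ℝ), (0 : ℝ)) + z.2 • ((0 : ℝ), (1 : ℝ)) := by ext <;> simp
    conv_lhs => rw [this]
    simp only [map_add, map_smul, smul_eq_mul]
  set α := φ (1, 0) with hα
  set β := φ (0, 1) with hβ
  set slope : V → ℝ := fun v =>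
    ((g v - g a).2 * α - (g v - g a).1 * β) / φ (g v - g a) with hslope
  have hid : ∀ u v, (α ^ 2 + β ^ 2) * orient (g a) (g u) (g v) =
      φ (g u - g a) * ((g v - g a).2 * α - (g v - g a).1 * β) -
      ((g u - g a).2 * α - (g u - g a).1 * β) * φ (g v - g a) := by
    intro u v
    rw [hφ', hφ' (g v - g a)]
    simp only [orient, Prod.fst_sub, Prod.snd_sub]
    ring
  have hαβ : ∀ v, v ≠ a → 0 < α ^ 2 + β ^ 2 := by
    intro v hv
    by_contra! h
    have h1 : α = 0 := by nlinarith [sq_nonneg α, sq_nonneg β]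
    have h2 : β = 0 := by nlinarith [sq_nonneg α, sq_nonneg β]
    have := hpos v hv
    rw [hφ', h1, h2] at this
    simp at this
  have hlt : ∀ u v, u ≠ a → v ≠ a → slope u < slope v → 0 < orient (g a) (g u) (g v) := by
    intro u v hu hv h
    have h1 := hpos u hu
    have h2 := hpos v hv
    simp only [hslope] at h
    rw [div_lt_div_iff₀ h1 h2] at h
    refine pos_of_mul_pos_right (a := α ^ 2 + β ^ 2) ?_ (hαβ u hu).le
    rw [hid]
    linarith
  have hne : ∀ u v, u ≠ a → v ≠ a → slope u = slope v → φ (g u - g a) ≤ φ (g v - g a) → u = v := by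
    intro u v hu hv h hle
    by_contra huv
    have h1 := hpos u hu
    have h2 := hpos v hv
    simp only [hslope] at h
    rw [div_eq_div_iff h1.ne' h2.ne'] at h
    have hor := hid u v
    have h3 : orient (g a) (g u) (g v) = 0 := by
      rcases mul_eq_zero.1 (show (α ^ 2 + β ^ 2) * orient (g a) (g u) (g v) = 0 by
        rw [hid]; linarith) with h4 | h4
      · exact absurd h4 (hαβ u hu).ne'
      · exact h4
    apply hhull u {a, v} (by
      rintro (h | h)
      · exact hu h
      · exact huv h)
    rw [Set.image_pair, convexHull_pair, segment_eq_image']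
    refine ⟨φ (g u - g a) / φ (g v - g a), ⟨div_nonneg h1.le h2.le, (div_le_one h2).2 hle⟩, ?_⟩
    have e₁ : φ (g u - g a) * ((g v).1 - (g a).1) = φ (g v - g a) * ((g u).1 - (g a).1) := by
      rw [hφ', hφ' (g v - g a)]
      simp only [orient, Prod.fst_sub, Prod.snd_sub] at h3 ⊢
      linear_combination -β * h3
    have e₂ : φ (g u - g a) * ((g v).2 - (g a).2) = φ (g v - g a) * ((g u).2 - (g a).2) := by
      rw [hφ', hφ' (g v - g a)]
      simp only [orient, Prod.fst_sub, Prod.snd_sub] at h3 ⊢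
      linear_combination α * h3
    ext
    · simp only [Prod.fst_add, Prod.smul_fst, Prod.fst_sub, smul_eq_mul]
      rw [div_mul_eq_mul_div, e₁, mul_div_cancel_left₀ _ h2.ne']
      ring
    · simp only [Prod.snd_add, Prod.smul_snd, Prod.snd_sub, smul_eq_mul]
      rw [div_mul_eq_mul_div, e₂, mul_div_cancel_left₀ _ h2.ne']
      ring
  refine ⟨fun v => if v = a then ⊥ else slope v, ?_, ?_⟩
  · intro u v huv
    simp only at huv
    by_cases hu : u = a <;> by_cases hv : v = a
    · rw [hu, hv]
    · simp [hu, hv] at huv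
    · simp [hu, hv] at huv
    · simp only [hu, hv, if_false, WithBot.coe_inj] at huv
      rcases le_total (φ (g u - g a)) (φ (g v - g a)) with h | h
      · exact hne u v hu hv huv h
      · exact (hne v u hv hu huv.symm h).symm
  · intro u v w huv hvw
    simp only at huv hvw
    have hv : v ≠ a := by rintro rfl; simp at huv
    have hw : w ≠ a := by rintro rfl; simp at hvw
    simp only [hv, hw, if_false, WithBot.coe_lt_coe] at hvw
    by_cases hu : u = a
    · subst hu
      exact hlt v w hv hw hvw
    simp only [hu, hv, if_false, WithBot.coe_lt_coe] at huv
    have h1 := hlt u v hu hv huv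
    have h2 := hlt v w hv hw hvw
    have h3 := hlt u w hu hw (huv.trans hvw)
    by_contra! h4
    apply hhull v {a, u, w} (by
      rintro (h | h | h)
      · exact hv h
      · subst h; exact lt_irrefl _ huv
      · rw [Set.mem_singleton_iff] at h; subst h; exact lt_irrefl _ hvw)
    have hsum : orient (g a) (g u) (g w) =
      -orient (g u) (g v) (g w) + orient (g a) (g v) (g w) + orient (g a) (g u) (g v) := by
      unfold orient; ring
    have hA : g a ∈ convexHull ℝ (g '' {a, u, w}) := subset_convexHull ℝ _ ⟨a, by simp, rfl⟩
    have hU : g u ∈ convexHull ℝ (g '' {a, u, w}) := subset_convexHull ℝ _ ⟨u, by simp, rfl⟩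
    have hW : g w ∈ convexHull ℝ (g '' {a, u, w}) := subset_convexHull ℝ _ ⟨w, by simp, rfl⟩
    have hc := (convex_convexHull ℝ (g '' {a, u, w})).sum_mem (t := Finset.univ)
      (w := ![-orient (g u) (g v) (g w) / orient (g a) (g u) (g w),
        orient (g a) (g v) (g w) / orient (g a) (g u) (g w),
        orient (g a) (g u) (g v) / orient (g a) (g u) (g w)]) (z := ![g a, g u, g w])
      (by
        intro i _
        fin_cases i
        · exact div_nonneg (by linarith) h3.le
        · exact div_nonneg h2.le h3.le
        · exact div_nonneg h1.le h3.le)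
      (by
        simp only [Fin.sum_univ_three, Matrix.cons_val_zero, Matrix.cons_val_one, Matrix.cons_val]
        field_simp
        linarith)
      (by
        intro i _
        fin_cases i
        · exact hA
        · exact hU
        · exact hW)
    convert hc using 1
    simp only [Fin.sum_univ_three, Matrix.cons_val_zero, Matrix.cons_val_one, Matrix.cons_val]
    have h3' := h3.ne'
    ext
    · simp only [Prod.fst_add, Prod.smul_fst, smul_eq_mul]
      field_simp
      unfold orient
      ring
    · simp only [Prod.snd_add, Prod.smul_snd, smul_eq_mul]
      field_simp
      unfold orient
      ring

/-- The diagonals of a convex quadrilateral intersect. -/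
theorem segment_inter_nonempty_of_orient {u w v x : ℝ × ℝ} (h₁ : 0 < orient u w v)
    (h₂ : 0 < orient u w x) (h₃ : 0 < orient u v x) (h₄ : 0 < orient w v x) :
    (segment ℝ u v ∩ segment ℝ w x).Nonempty := by
  have hD : 0 < orient w v x + orient u w x := by linarith
  have e : orient w v x + orient u w x = orient u v x + orient u w v := by unfold orient; ring
  have hD' := hD.ne'
  refine ⟨(orient w v x / (orient w v x + orient u w x)) • u +
    (orient u w x / (orient w v x + orient u w x)) • v,
    ⟨_, _, div_nonneg h₄.le hD.le, div_nonneg h₂.le hD.le, by field_simp, rfl⟩,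
    ⟨orient u v x / (orient w v x + orient u w x), orient u w v / (orient w v x + orient u w x),
      div_nonneg h₃.le hD.le, div_nonneg h₁.le hD.le, by rw [← add_div, ← e, div_self hD'], ?_⟩⟩
  ext
  · simp only [Prod.fst_add, Prod.smul_fst, smul_eq_mul]
    field_simp
    unfold orient
    ring
  · simp only [Prod.snd_add, Prod.smul_snd, smul_eq_mul]
    field_simp
    unfold orient
    ring

theorem IsCrossingFreeDrawing.exists_ordering {n : ℕ} (hn : 1 ≤ n) {G : SimpleGraph (Fin n)}
    {g : Fin n → ℝ × ℝ} (hg : IsCrossingFreeDrawing G g)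
    (hconv : InStrictlyConvexPosition (Set.range g)) :
    ∃ e : Fin n → Fin n, Function.Bijective e ∧
      IsNonInterleaving fun i j => ∃ u v, G.Adj u v ∧ (e u : ℕ) = i ∧ (e v : ℕ) = j := by
  classical
  obtain ⟨key, hinj, hkey⟩ := hconv.exists_key hg.1 ⟨0, hn⟩
  have hlt : ∀ v, (Finset.univ.filter fun u => key u < key v).card < n := by
    intro v
    have : (Finset.univ.filter fun u => key u < key v) ⊂ Finset.univ :=
      Finset.filter_ssubset.2 ⟨v, by simp, lt_irrefl _⟩
    simpa using Finset.card_lt_card this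
  set e : Fin n → Fin n := fun v => ⟨_, hlt v⟩ with he
  have hmono : ∀ u v, key u < key v → e u < e v := by
    intro u v huv
    apply Fin.mk_lt_mk.2
    apply Finset.card_lt_card
    refine ⟨fun w hw => ?_, fun h => ?_⟩
    · simp only [Finset.mem_filter, Finset.mem_univ, true_and] at hw ⊢
      exact hw.trans huv
    · have := h (Finset.mem_filter.2 ⟨Finset.mem_univ u, huv⟩)
      simp at this
  have hrev : ∀ u v, e u < e v → key u < key v := by
    intro u v h
    rcases lt_trichotomy (key u) (key v) with h1 | h1 | h1
    · exact h1
    · rw [hinj h1] at h; exact absurd h (lt_irrefl _)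
    · exact absurd (hmono _ _ h1) (lt_asymm h)
  refine ⟨e, Finite.injective_iff_bijective.1 fun u v huv => ?_, ?_⟩
  · by_contra hne
    rcases lt_or_gt_of_ne (hinj.ne hne) with h | h
    · exact (hmono _ _ h).ne huv
    · exact (hmono _ _ h).ne huv.symm
  · rintro _ _ _ _ h1 h2 h3 ⟨u, v, huv, rfl, rfl⟩ ⟨w, x, hwx, rfl, rfl⟩
    have k1 := hrev u w h1
    have k2 := hrev w v h2
    have k3 := hrev v x h3
    have huw : u ≠ w := by rintro rfl; exact lt_irrefl _ k1
    have hwv : w ≠ v := by rintro rfl; exact lt_irrefl _ k2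
    have hvx : v ≠ x := by rintro rfl; exact lt_irrefl _ k3
    have hux : u ≠ x := by rintro rfl; exact lt_irrefl _ (k1.trans (k2.trans k3))
    obtain ⟨z, hz⟩ := segment_inter_nonempty_of_orient (hkey u w v k1 k2)
      (hkey u w x k1 (k2.trans k3)) (hkey u v x (k1.trans k2) k3) (hkey w v x k2 k3)
    rw [hg.2 u v w x huv hwx (by
      rw [Ne, Sym2.eq_iff]
      rintro (⟨rfl, -⟩ | ⟨rfl, -⟩)
      · exact huw rfl
      · exact hux rfl)] at hz
    obtain ⟨y, ⟨hy₁, hy₂⟩, -⟩ := hz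
    rcases hy₁ with rfl | rfl <;> rcases hy₂ with h | h
    · exact huw h
    · exact hux h
    · exact hwv h.symm
    · exact hvx h

/-- An outerplanar graph can be drawn on every point set without collinear triples whose points
have distinct first coordinates. -/
theorem IsCrossingFreeDrawing.exists_drawing_on {n : ℕ} (hn : 2 ≤ n) {G : SimpleGraph (Fin n)}
    {g f : Fin n → ℝ × ℝ} (hg : IsCrossingFreeDrawing G g)
    (hconv : InStrictlyConvexPosition (Set.range g))
    (hx : ∀ u v, u ≠ v → (f u).1 ≠ (f v).1)
    (hgen : ∀ u v w, u ≠ v → u ≠ w → v ≠ w → orient (f u) (f v) (f w) ≠ 0) :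
    ∃ f' : Fin n → ℝ × ℝ, IsCrossingFreeDrawing G f' ∧ Set.range f = Set.range f' := by
  classical
  have hf : Function.Injective f := fun u v huv => by
    by_contra hne
    exact hx u v hne (congrArg Prod.fst huv)
  obtain ⟨e, he, hR⟩ := hg.exists_ordering (by omega) hconv
  obtain ⟨a, -, ha⟩ := Finset.univ.exists_min_image (fun v => (f v).1)
    ⟨(⟨0, by omega⟩ : Fin n), Finset.mem_univ _⟩
  have ha' : ∀ v, v ≠ a → 0 < (f v).1 - (f a).1 := fun v hv =>
    sub_pos.2 ((ha v (Finset.mem_univ _)).lt_of_ne (hx a v hv.symm))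
  have : Nontrivial (Fin n) := Fin.nontrivial_iff_two_le.2 hn
  obtain ⟨b, hb, hmin⟩ := (Finset.univ.erase a).exists_min_image
    (fun v => ((f v).2 - (f a).2) / ((f v).1 - (f a).1)) (by
      obtain ⟨v, hv⟩ := exists_ne a
      exact ⟨v, by simpa using hv⟩)
  have hba : b ≠ a := Finset.ne_of_mem_erase hb
  have hleft : ∀ v, v ≠ a → v ≠ b → 0 < orient (f a) (f b) (f v) := by
    intro v hva hvb
    have h1 := hmin v (by simpa using hva)
    rw [div_le_div_iff₀ (ha' b hba) (ha' v hva)] at h1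
    refine lt_of_le_of_ne ?_ (hgen a b v hba.symm hva.symm hvb.symm).symm
    unfold orient
    linarith
  set S : Finset (ℝ × ℝ) := ((Finset.univ.erase a).erase b).image f with hS
  have hSmem : ∀ s, s ∈ S ↔ ∃ v, (v ≠ b ∧ v ≠ a) ∧ f v = s := by simp [hS]
  have hcard : S.card = n - 2 := by
    rw [hS, Finset.card_image_of_injective _ hf, Finset.card_erase_of_mem hb,
      Finset.card_erase_of_mem (Finset.mem_univ a), Finset.card_univ, Fintype.card_fin]
    omega
  obtain ⟨F, hF0, hF1, hFS, hFd⟩ := hR.exists_drawing (n - 2) 0 (f a) (f b) S hcard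
    (hf.ne hba.symm) (by
      intro s hs
      obtain ⟨v, ⟨hvb, hva⟩, rfl⟩ := (hSmem s).1 hs
      exact hleft v hva hvb) (by
      have hr : ∀ s ∈ insert (f a) (insert (f b) (S : Set (ℝ × ℝ))), ∃ v, f v = s := by
        rintro s (rfl | rfl | hs)
        · exact ⟨a, rfl⟩
        · exact ⟨b, rfl⟩
        · obtain ⟨v, -, rfl⟩ := (hSmem s).1 hs
          exact ⟨v, rfl⟩
      intro s hs t ht u hu hst hsu htu
      obtain ⟨s, rfl⟩ := hr s hs
      obtain ⟨t, rfl⟩ := hr t ht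
      obtain ⟨u, rfl⟩ := hr u hu
      exact hgen s t u (fun h => hst (h ▸ rfl)) (fun h => hsu (h ▸ rfl)) fun h => htu (h ▸ rfl))
  rw [show 0 + (n - 2) + 1 = n - 1 by omega] at hF1 hFS hFd
  have hle : ∀ v, (e v : ℕ) ≤ n - 1 := fun v => by have := (e v).2; omega
  have hrange : Set.range f = Set.range fun v => F (e v) := by
    have hsurj : ∀ i, i < n → ∃ v, (e v : ℕ) = i := by
      intro i hi
      obtain ⟨v, hv⟩ := he.2 ⟨i, hi⟩
      exact ⟨v, by rw [hv]⟩
    apply Set.Subset.antisymm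
    · rintro _ ⟨v, rfl⟩
      by_cases hva : v = a
      · obtain ⟨w, hw⟩ := hsurj 0 (by omega)
        exact ⟨w, by simp only [hw, hF0, hva]⟩
      by_cases hvb : v = b
      · obtain ⟨w, hw⟩ := hsurj (n - 1) (by omega)
        exact ⟨w, by simp only [hw, hF1, hvb]⟩
      obtain ⟨i, hi, hFi⟩ := hFS.surjOn (Finset.mem_coe.2 ((hSmem _).2 ⟨v, ⟨hvb, hva⟩, rfl⟩))
      obtain ⟨w, hw⟩ := hsurj i (by have := hi.2; omega)
      exact ⟨w, by simp only [hw, hFi]⟩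
    · rintro _ ⟨v, rfl⟩
      simp only
      by_cases h0 : (e v : ℕ) = 0
      · exact ⟨a, by rw [h0, hF0]⟩
      by_cases h1 : (e v : ℕ) = n - 1
      · exact ⟨b, by rw [h1, hF1]⟩
      obtain ⟨w, -, hw⟩ := (hSmem _).1 (hFS.mapsTo
        (show (e v : ℕ) ∈ Set.Ioo 0 (n - 1) from ⟨by omega, by have := hle v; omega⟩))
      exact ⟨w, hw⟩
  have hσ : ∀ v, ∃ w, f w = F (e v) := fun v => by
    have : F (e v) ∈ Set.range f := by rw [hrange]; exact ⟨v, rfl⟩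
    exact this
  choose σ hσ using hσ
  have hσinj : Function.Injective σ := Finite.injective_iff_surjective.2 fun w => by
    have : f w ∈ Set.range fun v => F (e v) := by rw [← hrange]; exact ⟨w, rfl⟩
    obtain ⟨v, hv⟩ := this
    exact ⟨v, hf (by rw [hσ]; exact hv)⟩
  refine ⟨fun v => F (e v), isCrossingFreeDrawing_of_orient_ne_zero ?_ ?_ ?_, hrange⟩
  · intro u v huv
    simp only [← hσ] at huv
    exact hσinj (hf huv)
  · intro u v w huv huw hvw
    simp only [← hσ]
    exact hgen _ _ _ (hσinj.ne huv) (hσinj.ne huw) (hσinj.ne hvw)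
  · have hne : ∀ u v, u ≠ v → (e u : ℕ) ≠ e v := fun u v h h' => h (he.1 (Fin.ext h'))
    have key : ∀ a b c d, G.Adj a b → G.Adj c d → (e a : ℕ) < e b → (e c : ℕ) < e d → a ≠ c →
        a ≠ d → b ≠ c → b ≠ d →
        Disjoint (segment ℝ (F (e a)) (F (e b))) (segment ℝ (F (e c)) (F (e d))) :=
      fun a b c d hab hcd h1 h2 hac had hbc hbd =>
        hFd _ _ _ _ (Nat.zero_le _) h1 (hle b) (Nat.zero_le _) h2 (hle d) ⟨a, b, hab, rfl, rfl⟩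
          ⟨c, d, hcd, rfl, rfl⟩ (hne _ _ hac) (hne _ _ had) (hne _ _ hbc) (hne _ _ hbd)
    intro a b c d hab hcd hac had hbc hbd
    rcases (hne a b hab.ne).lt_or_gt with h1 | h1 <;> rcases (hne c d hcd.ne).lt_or_gt with h2 | h2
    · exact key a b c d hab hcd h1 h2 hac had hbc hbd
    · rw [segment_symm ℝ (F (e c))]
      exact key a b d c hab hcd.symm h1 h2 had hac hbd hbc
    · rw [segment_symm ℝ (F (e a))]
      exact key b a c d hab.symm hcd h1 h2 hbc hbd hac had
    · rw [segment_symm ℝ (F (e a)), segment_symm ℝ (F (e c))]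
      exact key b a d c hab.symm hcd.symm h1 h2 hbd hbc had hac

theorem isCrossingFreeDrawing_of_subsingleton {V : Type*} [Subsingleton V] (G : SimpleGraph V)
    (f : V → ℝ × ℝ) : IsCrossingFreeDrawing G f :=
  ⟨Function.injective_of_subsingleton f, fun a b _ _ hab =>
    absurd (Subsingleton.elim a b) hab.ne⟩

/-- A planar graph and an outerplanar graph on `n` vertices can be simultaneously
embedded without mapping on an `O(n²) × O(n³)` integer grid: there are crossing-free
straight-line drawings of the two graphs with the same image, consisting of integer
points with first coordinates in `[0, c·n²]` and second coordinates in `[0, c·n³]`. -/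
theorem planar_and_outerplanar_simultaneous_embedding_without_mapping :
    ∃ c : ℝ, 0 < c ∧ ∀ n : ℕ, 1 ≤ n → ∀ G₁ G₂ : SimpleGraph (Fin n),
      (∃ f : Fin n → ℝ × ℝ, IsCrossingFreeDrawing G₁ f) →
      (∃ g : Fin n → ℝ × ℝ, IsCrossingFreeDrawing G₂ g ∧
        InStrictlyConvexPosition (Set.range g)) →
      ∃ f₁ f₂ : Fin n → ℝ × ℝ,
        IsCrossingFreeDrawing G₁ f₁ ∧ IsCrossingFreeDrawing G₂ f₂ ∧
        Set.range f₁ = Set.range f₂ ∧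
        (∀ v : Fin n, ∃ a b : ℤ, f₁ v = ((a : ℝ), (b : ℝ)) ∧
          0 ≤ a ∧ (a : ℝ) ≤ c * (n : ℝ) ^ 2 ∧ 0 ≤ b ∧ (b : ℝ) ≤ c * (n : ℝ) ^ 3) := by
  refine ⟨50, by norm_num, ?_⟩
  rintro n hn G₁ G₂ ⟨f, hf⟩ ⟨g, hg, hconv⟩
  rcases hn.eq_or_lt with rfl | hn2
  · exact ⟨fun _ => (0, 0), fun _ => (0, 0), isCrossingFreeDrawing_of_subsingleton _ _,
      isCrossingFreeDrawing_of_subsingleton _ _, rfl, fun _ => ⟨0, 0, by simp⟩⟩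
  · have : Nontrivial (Fin n) := Fin.nontrivial_iff_two_le.2 hn2
    obtain ⟨_, _, E, hd, hE⟩ := hf.exists_disc
    obtain ⟨_, _, _, _, hs⟩ := hd.exists_isSchnyder
    obtain ⟨f₁, h₁, hx, hgen, hgrid⟩ := hs.exists_gridDrawing hn hE
    obtain ⟨f₂, h₂, hrange⟩ := hg.exists_drawing_on hn2 hconv hx hgen
    exact ⟨f₁, f₂, h₁, h₂, hrange, hgrid⟩
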